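/- Let D ⊆ ℂ be a nonempty open connected set, f : ℂ × D → ℂ a holomorphic function such that for every w ∈ D the entire function z ↦ f(z,w) is nonconstant, and a : D → ℂ a function such that f(z,w) ≠ a(w) for all z ∈ ℂ and all w ∈ D. Then there exists a set E ⊆ D, closed in D and discrete (every point of E is isolated in E, equivalently E has no accumulation point in D), such that a is analytic on D ∖ E, and for every w₀ ∈ E one has ‖a(w)‖ → ∞ as w → w₀ (w ∈ D ∖ {w₀}). -/

import Mathlib

open Filter

/-- If `‖deriv f‖ ≤ 2 ‖deriv f p‖` on a ball of radius `t` around `p`, the image of `f`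
contains a ball of radius `‖deriv f p‖ * t / 24`. -/
theorem ball_subset_range_of_norm_deriv_le {f : ℂ → ℂ} (hf : Differentiable ℂ f) {p : ℂ} {t : ℝ}
    (ht : 0 < t) (hp : deriv f p ≠ 0)
    (h : ∀ z ∈ Metric.ball p t, ‖deriv f z‖ ≤ 2 * ‖deriv f p‖) :
    Metric.ball (f p) (‖deriv f p‖ * t / 12 / 2) ⊆ Set.range f := by
  have hp' : 0 < ‖deriv f p‖ := norm_pos_iff.2 hp
  have hd : Differentiable ℂ (deriv f) := by
    have := (hf.contDiff (n := 2))
    exact (this.differentiable_deriv_two)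
  have hs : ∀ z ∈ Metric.closedBall p (t / 6), ‖deriv f z - deriv f p‖ ≤ ‖deriv f p‖ / 2 := by
    intro z hz
    have hz' : dist z p ≤ t / 6 := hz
    have := Complex.dist_le_div_mul_dist_of_mapsTo_ball (R₁ := t) (R₂ := 3 * ‖deriv f p‖)
      (c := p) (z := z) hd.differentiableOn (fun w hw => by
        rw [Metric.mem_closedBall, dist_eq_norm]
        have := norm_sub_le (deriv f w) (deriv f p)
        linarith [h w hw]) (by rw [Metric.mem_ball]; linarith)
    rw [dist_eq_norm] at this
    refine this.trans ?_
    calc 3 * ‖deriv f p‖ / t * dist z p ≤ 3 * ‖deriv f p‖ / t * (t / 6) := by gcongr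
      _ = ‖deriv f p‖ / 2 := by field_simp; norm_num
  have hlow : ∀ z ∈ Metric.sphere p (t / 6), ‖deriv f p‖ * t / 12 ≤ ‖f z - f p‖ := by
    intro z hz
    have hz' : ‖z - p‖ = t / 6 := by rw [← dist_eq_norm]; exact hz
    have hdz : ∀ x, HasDerivAt (fun z => f z - deriv f p * z) (deriv f x - deriv f p) x := by
      intro x
      exact ((hf x).hasDerivAt.sub ((hasDerivAt_id x).const_mul (deriv f p))).congr_deriv (by ring)
    have := (convex_closedBall p (t / 6)).norm_image_sub_le_of_norm_hasDerivWithin_le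
      (fun x _ => (hdz x).hasDerivWithinAt) hs (Metric.mem_closedBall_self (by positivity))
      (Metric.sphere_subset_closedBall hz)
    have e : f z - f p = (f z - deriv f p * z - (f p - deriv f p * p)) + deriv f p * (z - p) := by
      ring
    have h2 : ‖deriv f p * (z - p)‖ = ‖deriv f p‖ * (t / 6) := by rw [norm_mul, hz']
    have h3 := norm_sub_le (f z - f p) (f z - deriv f p * z - (f p - deriv f p * p))
    rw [show f z - f p - (f z - deriv f p * z - (f p - deriv f p * p)) = deriv f p * (z - p) by
      ring, h2] at h3
    rw [hz'] at this
    linarith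
  refine (DiffContOnCl.ball_subset_image_closedBall hf.diffContOnCl (by positivity) hlow
    ?_).trans (Set.image_subset_range _ _)
  have := (hf p).hasDerivAt.eventually_ne (c := f p) hp
  exact this.frequently.filter_mono nhdsWithin_le_nhds

/-- The range of a nonconstant entire function contains balls of arbitrarily large radius. -/
theorem exists_ball_subset_range {f : ℂ → ℂ} (hf : Differentiable ℂ f) {a : ℂ}
    (ha : deriv f a ≠ 0) (r : ℝ) : ∃ b, Metric.ball b r ⊆ Set.range f := by
  have ha' : 0 < ‖deriv f a‖ := norm_pos_iff.2 ha
  obtain ⟨R, hR, hRr⟩ : ∃ R : ℝ, 0 < R ∧ r ≤ R * ‖deriv f a‖ / 48 := by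
    refine ⟨48 * (|r| + 1) / ‖deriv f a‖, by positivity, ?_⟩
    field_simp
    linarith [le_abs_self r]
  have hd : Continuous (deriv f) := (hf.contDiff (n := 1)).continuous_deriv le_rfl
  obtain ⟨p, hp, hmax⟩ := (isCompact_closedBall a R).exists_isMaxOn
    (Metric.nonempty_closedBall.2 hR.le)
    (f := fun z => (R - dist z a) * ‖deriv f z‖) (by fun_prop)
  have hge : R * ‖deriv f a‖ ≤ (R - dist p a) * ‖deriv f p‖ := by
    simpa using hmax (Metric.mem_closedBall_self hR.le)
  have hpos : 0 < (R - dist p a) * ‖deriv f p‖ := lt_of_lt_of_le (by positivity) hge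
  have hpR : 0 < R - dist p a := by
    have : dist p a ≤ R := hp
    rcases (sub_nonneg.2 this).eq_or_lt with h | h
    · rw [← h, zero_mul] at hpos; exact absurd hpos (lt_irrefl _)
    · exact h
  have hp0 : deriv f p ≠ 0 := by
    intro h; rw [h] at hpos; simp at hpos
  refine ⟨f p, (Metric.ball_subset_ball ?_).trans
    (ball_subset_range_of_norm_deriv_le hf (t := (R - dist p a) / 2) (by positivity) hp0 ?_)⟩
  · nlinarith
  · intro z hz
    have hz1 : dist z p < (R - dist p a) / 2 := hz
    have htri := dist_triangle z p a
    have hzm : z ∈ Metric.closedBall a R := by rw [Metric.mem_closedBall]; linarith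
    have h1 : (R - dist z a) * ‖deriv f z‖ ≤ (R - dist p a) * ‖deriv f p‖ := hmax hzm
    have h2 : (R - dist p a) / 2 * ‖deriv f z‖ ≤ (R - dist z a) * ‖deriv f z‖ := by
      gcongr; linarith
    have h3 : (R - dist p a) * ‖deriv f z‖ ≤ (R - dist p a) * (2 * ‖deriv f p‖) := by linarith
    exact le_of_mul_le_mul_left h3 hpR

theorem exists_entire_log {f : ℂ → ℂ} (hf : Differentiable ℂ f) (h0 : ∀ z, f z ≠ 0) :
    ∃ g : ℂ → ℂ, Differentiable ℂ g ∧ ∀ z, Complex.exp (g z) = f z := by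
  have hd : Differentiable ℂ (deriv f) := (hf.contDiff (n := 2)).differentiable_deriv_two
  obtain ⟨g, hg⟩ := (hd.div hf h0).isExactOn_univ
  have hg' : ∀ z, HasDerivAt g (deriv f z / f z) z := fun z => hg z trivial
  have hgd : Differentiable ℂ g := fun z => (hg' z).differentiableAt
  have hF : ∀ z, HasDerivAt (fun z => Complex.exp (-g z) * f z) 0 z := by
    intro z
    refine (((hg' z).neg.cexp).mul (hf z).hasDerivAt).congr_deriv ?_
    rw [mul_assoc, neg_mul, div_mul_cancel₀ _ (h0 z)]
    rw [mul_neg, neg_add_cancel]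
  have hc := is_const_of_deriv_eq_zero (fun z => (hF z).differentiableAt) (fun z => (hF z).deriv)
  refine ⟨fun z => g z + Complex.log (Complex.exp (-g 0) * f 0), by fun_prop, fun z => ?_⟩
  rw [Complex.exp_add, Complex.exp_log (mul_ne_zero (Complex.exp_ne_zero _) (h0 0)), ← hc z 0,
    ← mul_assoc, ← Complex.exp_add]
  simp

theorem exists_entire_sqrt {f : ℂ → ℂ} (hf : Differentiable ℂ f) (h0 : ∀ z, f z ≠ 0) :
    ∃ g : ℂ → ℂ, Differentiable ℂ g ∧ ∀ z, g z ^ 2 = f z := by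
  obtain ⟨g, hg, hgf⟩ := exists_entire_log hf h0
  refine ⟨fun z => Complex.exp (g z / 2), by fun_prop, fun z => ?_⟩
  rw [← Complex.exp_nat_mul, ← hgf]
  congr 1
  push_cast
  ring

theorem exists_entire_cosh {f : ℂ → ℂ} (hf : Differentiable ℂ f) (h0 : ∀ z, f z ≠ 0)
    (h1 : ∀ z, f z ≠ 1) :
    ∃ g : ℂ → ℂ, Differentiable ℂ g ∧ ∀ z, Complex.cosh (g z) ^ 2 = f z := by
  obtain ⟨u, hu, huf⟩ := exists_entire_sqrt hf h0
  obtain ⟨v, hv, hvf⟩ := exists_entire_sqrt (f := fun z => f z - 1) (by fun_prop)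
    (fun z => sub_ne_zero.2 (h1 z))
  have huv : ∀ z, (u z + v z) * (u z - v z) = 1 := fun z => by
    linear_combination huf z - hvf z
  obtain ⟨g, hg, hgf⟩ := exists_entire_log (f := fun z => u z + v z) (by fun_prop)
    (fun z h => by have := huv z; rw [h] at this; simp at this)
  refine ⟨g, hg, fun z => ?_⟩
  have h2 : Complex.exp (-g z) = u z - v z := by
    rw [Complex.exp_neg, hgf]
    exact inv_eq_of_mul_eq_one_right (huv z)
  rw [Complex.cosh, hgf, h2, ← huf]
  ring

/-- The points where `cosh ^ 2` is an integer form a net. -/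
theorem exists_cosh_sq_eq_int (z : ℂ) :
    ∃ w : ℂ, dist w z < 4 ∧ ∃ n : ℤ, Complex.cosh w ^ 2 = n := by
  obtain ⟨x, hx, n, hn⟩ : ∃ x : ℝ, |x - z.re| ≤ 1 ∧ ∃ n : ℤ, Real.cosh x ^ 2 = n := by
    have key : ∀ t : ℝ, 0 ≤ t → ∃ x : ℝ, t ≤ x ∧ x ≤ t + 1 ∧ ∃ n : ℤ, Real.cosh x ^ 2 = n := by
      intro t ht
      have hcont : ContinuousOn (fun x => Real.cosh x ^ 2) (Set.Icc t (t + 1)) := by fun_prop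
      have hIVT := intermediate_value_Icc (by linarith : t ≤ t + 1) hcont
      have hgap : Real.cosh t ^ 2 + 1 ≤ Real.cosh (t + 1) ^ 2 := by
        rw [Real.cosh_sq, Real.cosh_sq, Real.sinh_add]
        have a1 : 1 ≤ Real.sinh 1 := Real.self_le_sinh_iff.2 zero_le_one
        have a2 : 1 ≤ Real.cosh t := Real.one_le_cosh t
        have a3 : 0 ≤ Real.sinh t := Real.sinh_nonneg_iff.2 ht
        have a4 : 1 ≤ Real.cosh 1 := Real.one_le_cosh 1
        have b1 : Real.sinh t ≤ Real.sinh t * Real.cosh 1 := le_mul_of_one_le_right a3 a4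
        have b2 : 1 ≤ Real.cosh t * Real.sinh 1 := one_le_mul_of_one_le_of_one_le a2 a1
        nlinarith
      obtain ⟨x, hx, hxn⟩ := hIVT (show ((⌈Real.cosh t ^ 2⌉ : ℤ) : ℝ) ∈ _ from
        ⟨Int.le_ceil _, by have := Int.ceil_lt_add_one (Real.cosh t ^ 2); linarith⟩)
      exact ⟨x, hx.1, hx.2, _, hxn⟩
    rcases le_total 0 z.re with h | h
    · obtain ⟨x, h1, h2, hn⟩ := key _ h
      exact ⟨x, abs_le.2 ⟨by linarith, by linarith⟩, hn⟩
    · obtain ⟨x, h1, h2, n, hn⟩ := key (-z.re) (by linarith)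
      exact ⟨-x, abs_le.2 ⟨by linarith, by linarith⟩, n, by rw [Real.cosh_neg, hn]⟩
  have hpi := Real.pi_pos
  have hpi4 := Real.pi_lt_four
  have hm := abs_sub_round (z.im / Real.pi)
  set m : ℤ := round (z.im / Real.pi)
  refine ⟨x + m * (Real.pi * Complex.I), ?_, n, ?_⟩
  · have him : |m * Real.pi - z.im| ≤ 2 := by
      have : m * Real.pi - z.im = -((z.im / Real.pi - m) * Real.pi) := by field_simp; ring
      rw [this, abs_neg, abs_mul, abs_of_pos hpi]
      nlinarith
    rw [dist_eq_norm]
    refine (Complex.norm_le_abs_re_add_abs_im _).trans_lt ?_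
    simp only [Complex.sub_re, Complex.add_re, Complex.ofReal_re, Complex.mul_re,
      Complex.intCast_re, Complex.intCast_im, Complex.I_re, Complex.ofReal_im, Complex.I_im,
      Complex.sub_im, Complex.add_im, Complex.mul_im]
    norm_num
    linarith
  · have hs : Complex.sinh (m * (Real.pi * Complex.I)) = 0 := by
      rw [← mul_assoc, Complex.sinh_mul_I, Complex.sin_int_mul_pi, zero_mul]
    have hc := Complex.cosh_sq (m * (Real.pi * Complex.I))
    rw [hs] at hc
    rw [Complex.cosh_add, hs, mul_zero, add_zero, mul_pow, hc, ← Complex.ofReal_cosh]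
    norm_num
    exact_mod_cast hn

theorem little_picard_zero_one {f : ℂ → ℂ} (hf : Differentiable ℂ f) (h0 : ∀ z, f z ≠ 0)
    (h1 : ∀ z, f z ≠ 1) (z w : ℂ) : f z = f w := by
  obtain ⟨F, hF, hFf⟩ : ∃ F : ℂ → ℂ, Differentiable ℂ F ∧
      ∀ z, Complex.exp (2 * Real.pi * Complex.I * F z) = f z := by
    obtain ⟨g, hg, hgf⟩ := exists_entire_log hf h0
    refine ⟨fun z => g z / (2 * Real.pi * Complex.I), by fun_prop, fun z => ?_⟩
    rw [mul_div_cancel₀ _ Complex.two_pi_I_ne_zero, hgf]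
  have hFn : ∀ z (n : ℤ), F z ≠ n := fun z n h => h1 z (by
    rw [← hFf, h, Complex.exp_eq_one_iff]; exact ⟨n, by ring⟩)
  obtain ⟨G, hG, hGF⟩ := exists_entire_cosh hF (fun z => by simpa using hFn z 0)
    (fun z => by simpa using hFn z 1)
  have hGc : ∀ z, deriv G z = 0 := by
    intro a
    by_contra ha
    obtain ⟨b, hb⟩ := exists_ball_subset_range hG ha 4
    obtain ⟨w, hw, n, hn⟩ := exists_cosh_sq_eq_int b
    obtain ⟨y, rfl⟩ := hb hw
    exact hFn y n (by rw [← hGF, hn])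
  rw [← hFf, ← hFf, ← hGF, ← hGF, is_const_of_deriv_eq_zero hG hGc z w]

/-- **Little Picard theorem**. -/
theorem little_picard {f : ℂ → ℂ} (hf : Differentiable ℂ f) {a b : ℂ} (hab : a ≠ b)
    (ha : ∀ z, f z ≠ a) (hb : ∀ z, f z ≠ b) (z w : ℂ) : f z = f w := by
  have hab' : b - a ≠ 0 := sub_ne_zero.2 hab.symm
  have := little_picard_zero_one (f := fun z => (f z - a) / (b - a)) (by fun_prop)
    (fun z => div_ne_zero (sub_ne_zero.2 (ha z)) hab')
    (fun z h => hb z (by rw [div_eq_one_iff_eq hab'] at h; linear_combination h)) z w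
  field_simp at this
  linear_combination this

/-- Real parts of polynomials are uniformly dense in the real continuous functions on the unit
circle. -/
theorem exists_polynomial_abs_re_sub_le {τ : ℂ → ℝ} (hτ : ContinuousOn τ (Metric.sphere 0 1))
    {δ : ℝ} (hδ : 0 < δ) :
    ∃ G : Polynomial ℂ, ∀ w ∈ Metric.sphere (0 : ℂ) 1, |(G.eval w).re - τ w| ≤ δ := by
  have : Fact (0 < 2 * Real.pi) := ⟨Real.two_pi_pos⟩
  have hmem : ∀ x : AddCircle (2 * Real.pi), (AddCircle.toCircle x : ℂ) ∈ Metric.sphere (0 : ℂ) 1 :=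
    fun x => by rw [mem_sphere_zero_iff_norm, Circle.norm_coe]
  let T : C(AddCircle (2 * Real.pi), ℂ) :=
    ⟨fun x => (τ (AddCircle.toCircle x) : ℂ), by
      refine Complex.continuous_ofReal.comp (hτ.comp_continuous ?_ hmem)
      exact continuous_subtype_val.comp AddCircle.continuous_toCircle⟩
  have hT : T ∈ (Submodule.span ℂ (Set.range (@fourier (2 * Real.pi)))).topologicalClosure := by
    rw [span_fourier_closure_eq_top]; trivial
  have key : ∀ S ∈ Submodule.span ℂ (Set.range (@fourier (2 * Real.pi))), ∀ c : ℂ,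
      ∃ G : Polynomial ℂ, ∀ x, (c * S x).re = (G.eval (AddCircle.toCircle x : ℂ)).re := by
    intro S hS
    induction hS using Submodule.span_induction with
    | mem S h =>
      obtain ⟨n, rfl⟩ := h
      intro c
      obtain ⟨m, rfl | rfl⟩ := n.eq_nat_or_neg
      · refine ⟨Polynomial.C c * Polynomial.X ^ m, fun x => ?_⟩
        simp [fourier_apply, AddCircle.toCircle_nsmul]
      · refine ⟨Polynomial.C (starRingEnd ℂ c) * Polynomial.X ^ m, fun x => ?_⟩
        rw [fourier_neg, ← Complex.conj_re]
        simp [fourier_apply, AddCircle.toCircle_nsmul]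
    | zero => exact fun c => ⟨0, by simp⟩
    | add S S' _ _ h h' =>
      intro c
      obtain ⟨G, hG⟩ := h c
      obtain ⟨G', hG'⟩ := h' c
      exact ⟨G + G', fun x => by
        rw [Polynomial.eval_add, Complex.add_re, ← hG, ← hG', ContinuousMap.add_apply, mul_add,
          Complex.add_re]⟩
    | smul a S _ h =>
      intro c
      obtain ⟨G, hG⟩ := h (c * a)
      exact ⟨G, fun x => by rw [← hG, ContinuousMap.smul_apply, smul_eq_mul, mul_assoc]⟩
  obtain ⟨S, hS, hTS⟩ := Metric.mem_closure_iff.1 hT δ hδ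
  obtain ⟨G, hG⟩ := key S hS 1
  refine ⟨G, fun w hw => ?_⟩
  obtain ⟨x, hx⟩ := (AddCircle.homeomorphCircle Real.two_pi_pos.ne').surjective
    (⟨w, by simpa [Submonoid.unitSphere] using hw⟩ : Circle)
  have hx' : (AddCircle.toCircle x : ℂ) = w := by
    have := congrArg (fun z : Circle => (z : ℂ)) hx
    rwa [AddCircle.homeomorphCircle_apply] at this
  have h1 : ‖S x - T x‖ ≤ δ := by
    rw [← dist_eq_norm]
    refine (ContinuousMap.dist_apply_le_dist x).trans ?_
    rw [dist_comm]; exact hTS.le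
  have h2 := (Complex.abs_re_le_norm _).trans h1
  have h3 : (T x).re = τ w := by rw [← hx']; simp [T]
  rwa [Complex.sub_re, h3, ← one_mul (S x), hG, hx'] at h2

theorem norm_circleAverage_le_of_norm_le {f : ℂ → ℂ} {c : ℂ} {R C : ℝ}
    (h : ∀ z ∈ Metric.sphere c |R|, ‖f z‖ ≤ C) : ‖Real.circleAverage f c R‖ ≤ C := by
  have h1 : ‖∫ θ in (0 : ℝ)..2 * Real.pi, f (circleMap c R θ)‖ ≤ C * |2 * Real.pi - 0| :=
    intervalIntegral.norm_integral_le_of_norm_le_const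
      fun θ _ => h _ (circleMap_mem_sphere' c R θ)
  rw [sub_zero, abs_of_pos Real.two_pi_pos] at h1
  rw [Real.circleAverage_def, norm_smul, Real.norm_of_nonneg (by positivity),
    inv_mul_le_iff₀ Real.two_pi_pos]
  linarith

/-- If the circle integrals of `g` on small circles around `x` vanish, the Cauchy-Riemann equation
holds at `x`. -/
theorem differentiableAt_of_circleAverage_eq_zero {g : ℂ → ℂ} {x : ℂ} (hg : DifferentiableAt ℝ g x)
    (hc : Continuous g)
    (h : ∀ᶠ r in nhdsWithin (0 : ℝ) (Set.Ioi 0),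
      Real.circleAverage (fun z => (z - x) * g z) x r = 0) :
    DifferentiableAt ℂ g x := by
  rw [differentiableAt_complex_iff_differentiableAt_real]
  refine ⟨hg, ?_⟩
  set L := fderiv ℝ g x with hL
  set A : ℂ := (L 1 - Complex.I * L Complex.I) / 2 with hA
  set B : ℂ := (L 1 + Complex.I * L Complex.I) / 2 with hB
  have hI := Complex.I_sq
  have hLAB : ∀ ζ : ℂ, L ζ = A * ζ + B * (starRingEnd ℂ) ζ := by
    intro ζ
    have e : ζ = ζ.re • (1 : ℂ) + ζ.im • Complex.I := by simp
    have e2 : L ζ = ζ.re * L 1 + ζ.im * L Complex.I := by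
      conv_lhs => rw [e, map_add, map_smul, map_smul]
      simp
    have e3 : ζ = ζ.re + ζ.im * Complex.I := (Complex.re_add_im ζ).symm
    have e4 : (starRingEnd ℂ) ζ = ζ.re - ζ.im * Complex.I := by
      apply Complex.ext <;> simp
    rw [e2, e4, hA, hB]
    linear_combination
      ((ζ.im : ℂ) * L Complex.I) * hI - ((L 1 - Complex.I * L Complex.I) / 2) * e3
  suffices hB0 : B = 0 by
    rw [smul_eq_mul]
    rw [hB] at hB0
    linear_combination (-2 * Complex.I) * hB0 + L Complex.I * hI
  by_contra hBne
  have hBpos : 0 < ‖B‖ := norm_pos_iff.2 hBne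
  have hlit := hg.hasFDerivAt.isLittleO.def (c := ‖B‖ / 2) (by positivity)
  obtain ⟨ε, hε, hball⟩ := Metric.eventually_nhds_iff.1 hlit
  obtain ⟨r, hr, hr0, hrε⟩ := (h.and (Ioo_mem_nhdsGT hε)).exists
  have hr' : |r| = r := abs_of_pos hr0
  have hsph : ∀ z ∈ Metric.sphere x |r|, ‖z - x‖ = r := fun z hz => by
    rw [← dist_eq_norm, ← hr']; exact hz
  have hLc : Continuous L := L.continuous
  have h1 : Real.circleAverage (fun z => (z - x) * (g x + A * (z - x))) x r = 0 := by
    have hd : Differentiable ℂ fun z : ℂ => (z - x) * (g x + A * (z - x)) := by fun_prop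
    rw [hd.diffContOnCl.circleAverage]
    simp
  have h2 : Real.circleAverage (fun z => (z - x) * (B * (starRingEnd ℂ) (z - x))) x r
      = r ^ 2 * B := by
    rw [Real.circleAverage_const_on_circle]
    intro z hz
    have := Complex.mul_conj (z - x)
    rw [Complex.normSq_eq_norm_sq, hsph z hz] at this
    push_cast at this
    linear_combination B * this
  have h3 : ‖Real.circleAverage (fun z => (z - x) * (g z - g x - L (z - x))) x r‖
      ≤ r * (‖B‖ / 2 * r) := by
    refine norm_circleAverage_le_of_norm_le fun z hz => ?_
    have hz' := hsph z hz
    rw [norm_mul, hz']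
    gcongr
    have := hball (y := z) (by rw [dist_eq_norm, hz']; exact hrε)
    rwa [hz'] at this
  have ci : ∀ F : ℂ → ℂ, Continuous F → CircleIntegrable F x r := fun F hF =>
    hF.continuousOn.circleIntegrable'
  have h4 : Real.circleAverage (fun z => (z - x) * (g z - g x - L (z - x))) x r
      = - (r ^ 2 * B) := by
    have e : (fun z => (z - x) * (g z - g x - L (z - x))) =
        ((fun z => (z - x) * g z) - fun z => (z - x) * (g x + A * (z - x))) -
          fun z => (z - x) * (B * (starRingEnd ℂ) (z - x)) := by
      funext z
      simp only [Pi.sub_apply, hLAB]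
      ring
    have c1 : Continuous fun z => (z - x) * g z := by fun_prop
    have c2 : Continuous fun z => (z - x) * (g x + A * (z - x)) := by fun_prop
    have c3 : Continuous fun z => (z - x) * (B * (starRingEnd ℂ) (z - x)) := by
      have := Complex.continuous_conj
      fun_prop
    rw [e, Real.circleAverage_sub ((ci _ c1).sub (ci _ c2)) (ci _ c3),
      Real.circleAverage_sub (ci _ c1) (ci _ c2), hr, h1, h2]
    ring
  rw [h4, norm_neg, norm_mul, norm_pow, Complex.norm_real, Real.norm_of_nonneg hr0.le] at h3
  have : 0 < r ^ 2 * ‖B‖ := by positivity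
  nlinarith

/-- **Morera's theorem** for circles. -/
theorem differentiableOn_ball_of_circleAverage_eq_zero {g : ℂ → ℂ} (hg : Continuous g) {x : ℂ}
    {r : ℝ} (hr : 0 < r)
    (h : ∀ c R, 0 < R → Metric.closedBall c R ⊆ Metric.ball x (2 * r) →
      Real.circleAverage (fun z => (z - c) * g z) c R = 0) :
    DifferentiableOn ℂ g (Metric.ball x r) := by
  let φ : ℕ → ContDiffBump (0 : ℂ) := fun n =>
    ⟨r / (2 * (n + 2)), r / (n + 2), by positivity, by
      rw [div_lt_div_iff₀ (by positivity) (by positivity)]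
      have : (0 : ℝ) < n + 2 := by positivity
      nlinarith⟩
  let G : ℕ → ℂ → ℂ := fun n =>
    MeasureTheory.convolution ((φ n).normed MeasureTheory.volume) g
      (ContinuousLinearMap.lsmul ℝ ℝ) MeasureTheory.volume
  have hGc : ∀ n, ContDiff ℝ 1 (G n) := fun n =>
    ((φ n).hasCompactSupport_normed).contDiff_convolution_left _ (φ n).contDiff_normed
      hg.locallyIntegrable
  have hrOut : ∀ n, (φ n).rOut < r := fun n => by
    change r / ((n : ℝ) + 2) < r
    rw [div_lt_iff₀ (by positivity)]
    have : (0 : ℝ) ≤ n := n.cast_nonneg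
    nlinarith
  have hlim : Tendsto (fun n => (φ n).rOut) atTop (nhds 0) := by
    change Tendsto (fun n : ℕ => r / ((n : ℝ) + 2)) atTop (nhds 0)
    exact tendsto_const_nhds.div_atTop
      (tendsto_atTop_add_const_right _ _ tendsto_natCast_atTop_atTop)
  have hGz : ∀ n c R, 0 < R → Metric.closedBall c R ⊆ Metric.ball x r →
      Real.circleAverage (fun z => (z - c) * G n z) c R = 0 := by
    intro n c R hR hcR
    set ψ : ℂ → ℝ := (φ n).normed MeasureTheory.volume with hψ
    have hψc : Continuous ψ := (φ n).continuous_normed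
    have hψ0 : ∀ t, t ∉ Metric.closedBall (0 : ℂ) (φ n).rOut → ψ t = 0 := fun t ht => by
      rw [← Function.notMem_support, hψ, ContDiffBump.support_normed_eq]
      exact fun h => ht (Metric.ball_subset_closedBall h)
    have hGe : ∀ z, (z - c) * G n z =
        ∫ t in Metric.closedBall (0 : ℂ) (φ n).rOut, (ψ t : ℂ) * ((z - c) * g (z - t)) := by
      intro z
      rw [MeasureTheory.setIntegral_eq_integral_of_forall_compl_eq_zero (fun t ht => by
        rw [hψ0 t ht]; simp)]
      simp only [G, MeasureTheory.convolution_def]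
      rw [← MeasureTheory.integral_const_mul]
      refine MeasureTheory.integral_congr_ae (Eventually.of_forall fun t => ?_)
      simp only [ContinuousLinearMap.lsmul_apply, Complex.real_smul]
      ring
    have hin : ∀ t ∈ Metric.closedBall (0 : ℂ) (φ n).rOut,
        ∫ θ in (0 : ℝ)..2 * Real.pi,
          (ψ t : ℂ) * ((circleMap c R θ - c) * g (circleMap c R θ - t)) = 0 := by
      intro t ht
      have ht' : ‖t‖ ≤ (φ n).rOut := by simpa using ht
      have := h (c - t) R hR (fun z hz => by
        have hz' : z + t ∈ Metric.ball x r := hcR (by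
          rw [Metric.mem_closedBall, dist_eq_norm] at hz ⊢
          rwa [show z + t - c = z - (c - t) by ring])
        have h1 : dist (z + t) x < r := hz'
        have h2 : dist z (z + t) = ‖t‖ := by rw [dist_eq_norm]; simp
        have h3 := dist_triangle z (z + t) x
        have h4 := hrOut n
        rw [Metric.mem_ball]; linarith)
      rw [Real.circleAverage_def, smul_eq_zero_iff_right (by positivity)] at this
      rw [intervalIntegral.integral_const_mul, ← mul_zero (ψ t : ℂ), ← this]
      congr 2
      funext θ
      simp only [circleMap]
      ring_nf
    rw [Real.circleAverage_def]
    simp only [hGe]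
    rw [intervalIntegral.integral_of_le Real.two_pi_pos.le,
      MeasureTheory.integral_integral_swap, MeasureTheory.setIntegral_eq_zero_of_forall_eq_zero,
      smul_zero]
    · intro t ht
      rw [← intervalIntegral.integral_of_le Real.two_pi_pos.le]
      exact hin t ht
    · rw [MeasureTheory.Measure.prod_restrict]
      refine MeasureTheory.IntegrableOn.mono_set
        (t := Set.Icc 0 (2 * Real.pi) ×ˢ Metric.closedBall (0 : ℂ) (φ n).rOut) ?_
        (Set.prod_mono Set.Ioc_subset_Icc_self subset_rfl)
      refine ContinuousOn.integrableOn_compact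
        (isCompact_Icc.prod (isCompact_closedBall _ _)) (Continuous.continuousOn ?_)
      have := continuous_circleMap c R
      simp only [Function.uncurry_def]
      fun_prop
  have hGd : ∀ n, DifferentiableOn ℂ (G n) (Metric.ball x r) := by
    intro n y hy
    refine (differentiableAt_of_circleAverage_eq_zero ((hGc n).differentiable one_ne_zero y)
      (hGc n).continuous ?_).differentiableWithinAt
    obtain ⟨ε, hε, hεb⟩ := Metric.isOpen_iff.1 Metric.isOpen_ball y hy
    filter_upwards [Ioo_mem_nhdsGT hε] with s hs
    exact hGz n y s hs.1 ((Metric.closedBall_subset_ball hs.2).trans hεb)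
  refine TendstoLocallyUniformlyOn.differentiableOn (F := G) (φ := atTop) ?_
    (Eventually.of_forall hGd) Metric.isOpen_ball
  refine TendstoUniformlyOn.tendstoLocallyUniformlyOn ?_
  rw [Metric.tendstoUniformlyOn_iff]
  intro ε hε
  have huc := (isCompact_closedBall x (2 * r)).uniformContinuousOn_of_continuous hg.continuousOn
  obtain ⟨δ, hδ, hδu⟩ := Metric.uniformContinuousOn_iff.1 huc (ε / 2) (by positivity)
  filter_upwards [hlim.eventually (gt_mem_nhds hδ)] with n hn y hy
  have hy' : dist y x < r := hy
  rw [dist_comm]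
  refine lt_of_le_of_lt (ContDiffBump.dist_normed_convolution_le hg.aestronglyMeasurable
    (ε := ε / 2) fun z hz => ?_) (by linarith)
  have hz' : dist z y < (φ n).rOut := hz
  have := dist_triangle z y x
  have := hrOut n
  exact (hδu z (by rw [Metric.mem_closedBall]; linarith) y
    (by rw [Metric.mem_closedBall]; linarith) (by linarith)).le

theorem circleAverage_re_of_differentiable {G : ℂ → ℂ} (hG : Differentiable ℂ G) (c : ℂ) (R : ℝ) :
    Real.circleAverage (fun z => (G z).re) c R = (G c).re := by
  have h := Complex.reCLM.circleAverage_comp_comm (f := G) (c := c) (R := R)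
    hG.continuous.continuousOn.circleIntegrable'
  rw [hG.diffContOnCl.circleAverage] at h
  exact h

theorem norm_circleAverage_le_circleAverage_norm (f : ℂ → ℂ) (c : ℂ) (R : ℝ) :
    ‖Real.circleAverage f c R‖ ≤ Real.circleAverage (fun z => ‖f z‖) c R := by
  rw [Real.circleAverage_def, Real.circleAverage_def, norm_smul,
    Real.norm_of_nonneg (by positivity), smul_eq_mul]
  gcongr
  exact intervalIntegral.norm_integral_le_integral_norm Real.two_pi_pos.le

/-- A maximum principle for functions that are locally uniformly close to holomorphic functions. -/
theorem norm_le_of_locally_near_analytic {F : ℂ → ℂ} {s η M : ℝ}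
    (hF : ContinuousOn F (Metric.closedBall 0 1)) (hs : 0 < s) (hs1 : s < 1) (hη : 0 < η)
    (hloc : ∀ v : ℂ, ‖v‖ < 1 - s → ∃ H : ℂ → ℂ, AnalyticOnNhd ℂ H (Metric.closedBall 0 1) ∧
      ∀ w ∈ Metric.closedBall v s, ‖F w - H w‖ ≤ η)
    (hcol : ∀ w : ℂ, 1 - s ≤ ‖w‖ → ‖w‖ ≤ 1 → ‖F w‖ ≤ M) :
    ‖F 0‖ ≤ M + 3 * η / s ^ 2 := by
  set l : ℝ := 3 * η / s ^ 2 with hl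
  have hl0 : 0 < l := by positivity
  obtain ⟨v, hv, hmax⟩ := (isCompact_closedBall (0 : ℂ) 1).exists_isMaxOn
    (Metric.nonempty_closedBall.2 zero_le_one)
    (f := fun w => ‖F w‖ + l * ‖w‖ ^ 2) (by fun_prop)
  have hmax' : ∀ w : ℂ, ‖w‖ ≤ 1 → ‖F w‖ + l * ‖w‖ ^ 2 ≤ ‖F v‖ + l * ‖v‖ ^ 2 := fun w hw =>
    hmax (by simpa using hw)
  have hv1 : ‖v‖ ≤ 1 := by simpa using hv
  by_cases hvs : 1 - s ≤ ‖v‖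
  · have h0 := hmax' 0 (by simp)
    have h1 := hcol v hvs hv1
    have h2 : ‖v‖ ^ 2 ≤ 1 := pow_le_one₀ (norm_nonneg _) hv1
    simp only [norm_zero, ne_eq, OfNat.ofNat_ne_zero, not_false_eq_true, zero_pow, mul_zero,
      add_zero] at h0
    nlinarith
  · exfalso
    push Not at hvs
    obtain ⟨H, hHa, hH⟩ := hloc v hvs
    have hsub : Metric.closedBall v s ⊆ Metric.closedBall 0 1 := fun w hw => by
      have h1 : dist w v ≤ s := hw
      have h2 := dist_triangle w v 0
      rw [dist_zero_right v] at h2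
      rw [Metric.mem_closedBall]; linarith
    have habs : |s| = s := abs_of_pos hs
    have hHd : DiffContOnCl ℂ H (Metric.ball v |s|) := by
      rw [habs]
      refine ⟨hHa.differentiableOn.mono (Metric.ball_subset_closedBall.trans hsub), ?_⟩
      rw [closure_ball v hs.ne']
      exact hHa.continuousOn.mono hsub
    have hHc : ContinuousOn H (Metric.sphere v |s|) := by
      rw [habs]
      exact hHa.continuousOn.mono (Metric.sphere_subset_closedBall.trans hsub)
    let Q : ℂ → ℂ := fun w => (‖F v‖ + l * ‖v‖ ^ 2 + η : ℝ) -
      l * ((‖v‖ ^ 2 + s ^ 2 : ℝ) + 2 * (starRingEnd ℂ v * (w - v)))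
    have hQd : Differentiable ℂ Q := by fun_prop
    have hle : ∀ w ∈ Metric.sphere v |s|, ‖H w‖ ≤ (Q w).re := by
      intro w hw
      rw [habs] at hw
      have hw' : w ∈ Metric.closedBall v s := Metric.sphere_subset_closedBall hw
      have hws : ‖w - v‖ = s := by rw [← dist_eq_norm]; exact hw
      have h1 := hH w hw'
      have h2 := hmax' w (by simpa using hsub hw')
      have h3 : ‖H w‖ ≤ ‖F w‖ + η := by
        have := norm_sub_norm_le (H w) (F w)
        rw [norm_sub_rev] at this
        linarith
      have h4 : ‖w‖ ^ 2 = ‖v‖ ^ 2 + s ^ 2 + 2 * (starRingEnd ℂ v * (w - v)).re := by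
        rw [← hws, ← Complex.normSq_eq_norm_sq, ← Complex.normSq_eq_norm_sq,
          ← Complex.normSq_eq_norm_sq]
        simp only [Complex.normSq_apply, Complex.mul_re, Complex.sub_re, Complex.sub_im,
          Complex.conj_re, Complex.conj_im]
        ring
      have h5 : (Q w).re = ‖F v‖ + l * ‖v‖ ^ 2 + η -
          l * (‖v‖ ^ 2 + s ^ 2 + 2 * (starRingEnd ℂ v * (w - v)).re) := by
        simp only [Q]
        rw [Complex.sub_re, Complex.ofReal_re, Complex.re_ofReal_mul, Complex.add_re,
          Complex.ofReal_re, show (2 : ℂ) = ((2 : ℝ) : ℂ) by norm_num, Complex.re_ofReal_mul]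
      rw [h5, ← h4]
      linarith
    have havg : ‖H v‖ ≤ (Q v).re := by
      rw [← hHd.circleAverage, ← circleAverage_re_of_differentiable hQd v s]
      refine (norm_circleAverage_le_circleAverage_norm _ _ _).trans
        (Real.circleAverage_mono hHc.norm.circleIntegrable' ?_ hle)
      exact (Complex.continuous_re.comp hQd.continuous).continuousOn.circleIntegrable'
    have h6 : (Q v).re = ‖F v‖ + l * ‖v‖ ^ 2 + η - l * (‖v‖ ^ 2 + s ^ 2) := by
      simp only [Q]
      rw [sub_self, mul_zero, mul_zero, add_zero, ← Complex.ofReal_mul, ← Complex.ofReal_sub,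
        Complex.ofReal_re]
    have h7 := hH v (Metric.mem_closedBall_self hs.le)
    have h8 := norm_sub_norm_le (F v) (H v)
    have h9 : l * s ^ 2 = 3 * η := by rw [hl]; field_simp
    nlinarith

/-- A strict upper bound on the unit circle persists on a collar. -/
theorem exists_collar {φ : ℂ → ℝ} (hφ : ContinuousOn φ (Metric.closedBall 0 1)) {K : ℝ}
    (h : ∀ w ∈ Metric.sphere (0 : ℂ) 1, φ w < K) :
    ∃ s, 0 < s ∧ s < 1 ∧ ∀ w : ℂ, 1 - s ≤ ‖w‖ → ‖w‖ ≤ 1 → φ w < K := by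
  have hcl : IsCompact (Metric.closedBall (0 : ℂ) 1 ∩ φ ⁻¹' Set.Ici K) :=
    (isCompact_closedBall 0 1).of_isClosed_subset
      (hφ.preimage_isClosed_of_isClosed Metric.isClosed_closedBall isClosed_Ici)
      Set.inter_subset_left
  rcases (Metric.closedBall (0 : ℂ) 1 ∩ φ ⁻¹' Set.Ici K).eq_empty_or_nonempty with he | hne
  · refine ⟨1 / 2, by norm_num, by norm_num, fun w _ hw => ?_⟩
    by_contra hK
    exact Set.eq_empty_iff_forall_notMem.1 he w ⟨by simpa using hw, not_lt.1 hK⟩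
  · obtain ⟨v, hv, hmax⟩ := hcl.exists_isMaxOn hne continuous_norm.continuousOn
    have hv1 : ‖v‖ ≤ 1 := by simpa using hv.1
    have hv2 : ‖v‖ < 1 := by
      refine lt_of_le_of_ne hv1 fun h1 => ?_
      exact absurd (h v (by simpa using h1)) (not_lt.2 hv.2)
    refine ⟨(1 - ‖v‖) / 2, by linarith, by linarith [norm_nonneg v], fun w hw1 hw2 => ?_⟩
    by_contra hK
    have : ‖w‖ ≤ ‖v‖ := hmax (show w ∈ _ from ⟨by simpa using hw2, not_lt.1 hK⟩)
    linarith

/-- Functions holomorphic near the closed unit disc. -/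
def discAnalytic : Subalgebra ℂ (ℂ → ℂ) where
  carrier := {f | AnalyticOnNhd ℂ f (Metric.closedBall 0 1)}
  mul_mem' hf hg := AnalyticOnNhd.mul hf hg
  add_mem' hf hg := AnalyticOnNhd.add hf hg
  algebraMap_mem' _ := analyticOnNhd_const

/-- Evaluation at `w` of functions holomorphic near the closed unit disc. -/
def discEval (w : ℂ) : discAnalytic →+* ℂ :=
  (Pi.evalRingHom (fun _ : ℂ => ℂ) w).comp discAnalytic.val.toRingHom

@[simp] theorem discEval_apply (w : ℂ) (f : discAnalytic) : discEval w f = (f : ℂ → ℂ) w := rfl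

/-- The value at `(w, b)` of a polynomial in `b` whose coefficients are holomorphic in `w`. -/
noncomputable def polyEval (P : Polynomial discAnalytic) (w b : ℂ) : ℂ :=
  P.eval₂ (discEval w) b

theorem polyEval_eq_sum (P : Polynomial discAnalytic) (w b : ℂ) :
    polyEval P w b = ∑ i ∈ Finset.range (P.natDegree + 1), (P.coeff i : ℂ → ℂ) w * b ^ i :=
  Polynomial.eval₂_eq_sum_range _ _

theorem differentiable_polyEval (P : Polynomial discAnalytic) (w : ℂ) :
    Differentiable ℂ (polyEval P w) := by
  have : polyEval P w = fun b => (P.map (discEval w)).eval b := by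
    funext b; rw [Polynomial.eval_map]; rfl
  rw [this]
  exact Polynomial.differentiable _

/-- Translating the second variable by a holomorphic function. -/
theorem polyEval_comp (P : Polynomial discAnalytic) (h : discAnalytic) (w b : ℂ) :
    polyEval (P.comp (Polynomial.X + Polynomial.C h)) w b = polyEval P w (b + (h : ℂ → ℂ) w) := by
  simp [polyEval, Polynomial.eval₂_comp]

theorem exists_primitive_mul_polyEval (P : Polynomial discAnalytic) {φ : ℂ → ℂ}
    (hφ : Differentiable ℂ φ) :
    ∃ R : ℂ → ℂ → ℂ, (∀ b, AnalyticOnNhd ℂ (fun w => R w b) (Metric.closedBall 0 1)) ∧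
      ContinuousOn (Function.uncurry R) (Metric.closedBall 0 1 ×ˢ Set.univ) ∧
      ∀ w b, HasDerivAt (R w) (φ b * polyEval P w b) b := by
  have hQ : ∀ i : ℕ, ∃ Q : ℂ → ℂ, ∀ b, HasDerivAt Q (b ^ i * φ b) b := by
    intro i
    obtain ⟨Q, hQ⟩ := (show Differentiable ℂ fun b => b ^ i * φ b by fun_prop).isExactOn_univ
    exact ⟨Q, fun b => hQ b trivial⟩
  choose Q hQ using hQ
  refine ⟨fun w b => ∑ i ∈ Finset.range (P.natDegree + 1), (P.coeff i : ℂ → ℂ) w * Q i b,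
    fun b => ?_, ?_, fun w b => ?_⟩
  · refine Finset.analyticOnNhd_fun_sum _ fun i _ => ?_
    exact AnalyticOnNhd.mul (P.coeff i).2 analyticOnNhd_const
  · refine continuousOn_finsetSum _ fun i _ => ContinuousOn.mul ?_ ?_
    · exact (P.coeff i).2.continuousOn.comp continuousOn_fst fun x hx => hx.1
    · exact ((Differentiable.continuous fun b => (hQ i b).differentiableAt).comp
        continuous_snd).continuousOn
  · refine (HasDerivAt.fun_sum (u := Finset.range (P.natDegree + 1))
      fun i _ => (hQ i b).const_mul ((P.coeff i : ℂ → ℂ) w)).congr_deriv ?_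
    rw [polyEval_eq_sum, Finset.mul_sum]
    exact Finset.sum_congr rfl fun i _ => by ring

/-- A sequence of polynomials in `b`, with coefficients holomorphic in `w`, of at most exponential
growth, which decays superexponentially along the graph of `α` but, over `w = 0`, only at countably
many points. -/
structure TinyFamily (P : ℕ → Polynomial discAnalytic) (α : ℂ → ℂ) : Prop where
  continuousOn : ContinuousOn α (Metric.closedBall 0 1)
  bound : ∀ L : ℝ, ∃ C : ℝ, 0 < C ∧ ∀ n, ∀ w ∈ Metric.closedBall (0 : ℂ) 1, ∀ b : ℂ, ‖b‖ ≤ L →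
    ‖polyEval (P n) w b‖ ≤ C ^ n
  tiny : ∀ q : ℝ, 0 < q → ∃ s, 0 < s ∧ ∃ C, 0 < C ∧ ∀ n, ∀ w ∈ Metric.closedBall (0 : ℂ) 1, ∀ b : ℂ,
    ‖b - α w‖ ≤ s → ‖polyEval (P n) w b‖ ≤ C * q ^ n
  countable : {x : ℂ | ∀ q : ℝ, 0 < q → ∃ C, ∀ n, ‖polyEval (P n) 0 x‖ ≤ C * q ^ n}.Countable

theorem TinyFamily.sub {P : ℕ → Polynomial discAnalytic} {α : ℂ → ℂ} (hP : TinyFamily P α)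
    (h : discAnalytic) :
    TinyFamily (fun n => (P n).comp (Polynomial.X + Polynomial.C h))
      (fun w => α w - (h : ℂ → ℂ) w) := by
  have hhc : ContinuousOn (h : ℂ → ℂ) (Metric.closedBall 0 1) := h.2.continuousOn
  refine ⟨hP.continuousOn.sub hhc, fun L => ?_, fun q hq => ?_, ?_⟩
  · obtain ⟨M, hM⟩ := (isCompact_closedBall (0 : ℂ) 1).exists_bound_of_continuousOn hhc
    obtain ⟨C, hC0, hC⟩ := hP.bound (L + M)
    refine ⟨C, hC0, fun n w hw b hb => ?_⟩
    rw [polyEval_comp]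
    exact hC n w hw _ ((norm_add_le _ _).trans (add_le_add hb (hM w hw)))
  · obtain ⟨s, hs, C, hC0, hC⟩ := hP.tiny q hq
    refine ⟨s, hs, C, hC0, fun n w hw b hb => ?_⟩
    rw [polyEval_comp]
    refine hC n w hw _ ?_
    rwa [show b + (h : ℂ → ℂ) w - α w = b - (α w - (h : ℂ → ℂ) w) by ring]
  · simp only [polyEval_comp]
    exact hP.countable.preimage (add_left_injective _)

theorem norm_cexp_neg_nat_mul_sq (κ : ℝ) (n : ℕ) (b : ℂ) (t : ℝ) :
    ‖Complex.exp (-(n * κ) * (b - t) ^ 2)‖ = Real.exp (κ * (b.im ^ 2 - (b.re - t) ^ 2)) ^ n := by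
  rw [Complex.norm_exp, ← Real.exp_nat_mul]
  congr 1
  have : (-(n * κ) * (b - t) ^ 2 : ℂ) = ((-(n * κ) : ℝ) : ℂ) * (b - t) ^ 2 := by push_cast; ring
  rw [this, Complex.re_ofReal_mul, sq (b - (t : ℂ)), Complex.mul_re]
  simp only [Complex.sub_re, Complex.sub_im, Complex.ofReal_re, Complex.ofReal_im]
  ring

theorem norm_cexp_nat_mul (κ : ℝ) (n : ℕ) (b : ℂ) :
    ‖Complex.exp (n * κ * b)‖ = Real.exp (κ * b.re) ^ n := by
  rw [Complex.norm_exp, ← Real.exp_nat_mul]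
  congr 1
  have : (n * κ * b : ℂ) = ((n * κ : ℝ) : ℂ) * b := by push_cast; ring
  rw [this, Complex.re_ofReal_mul]
  ring

/-- The gaussian weight times the complex conjugate of the restriction to the real line. -/
noncomputable def conjWeight (P : ℕ → Polynomial discAnalytic) (κ t : ℝ) (n : ℕ) (b : ℂ) : ℂ :=
  Complex.exp (-(n * κ) * (b - t) ^ 2) *
    starRingEnd ℂ (polyEval (P n) 0 (starRingEnd ℂ b))

theorem differentiable_conjWeight (P : ℕ → Polynomial discAnalytic) (κ t : ℝ) (n : ℕ) :
    Differentiable ℂ (conjWeight P κ t n) := by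
  have h : Differentiable ℂ fun b => starRingEnd ℂ (polyEval (P n) 0 (starRingEnd ℂ b)) := by
    intro b
    have := (differentiable_polyEval (P n) 0 (starRingEnd ℂ b)).conj_conj
    rwa [Complex.conj_conj] at this
  exact Differentiable.mul (by fun_prop) h

theorem TinyFamily.norm_primitive_sub_le {P : ℕ → Polynomial discAnalytic} {α : ℂ → ℂ}
    (hP : TinyFamily P α) {e t ε : ℝ} (hε : ∀ w ∈ Metric.sphere (0 : ℂ) 1, |(α w).im| ≤ ε)
    {τ : ℂ → ℝ} (hτc : ContinuousOn τ (Metric.closedBall 0 1))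
    (hτ : ∀ w ∈ Metric.closedBall (0 : ℂ) 1, ∀ θ ∈ Set.Icc (0 : ℝ) 1,
      τ w ≤ (e + θ * ((α w).re - e) - t) ^ 2)
    (havg : ε ^ 2 < Real.circleAverage τ 0 1) :
    ∃ C c : ℝ, 0 < C ∧ 0 < c ∧ ∀ κ : ℝ, 0 < κ → ∃ K, 0 < K ∧ ∀ n : ℕ, ∀ R : ℂ → ℂ,
      (∀ b, HasDerivAt R (conjWeight P κ t n b * polyEval (P n) 0 b) b) →
      ‖R (α 0) - R e‖ ≤ K * (C * Real.exp (-(κ * c))) ^ n := by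
  have hcb := isCompact_closedBall (0 : ℂ) 1
  have hsph : Metric.sphere (0 : ℂ) 1 ⊆ Metric.closedBall 0 1 := Metric.sphere_subset_closedBall
  obtain ⟨M, hM⟩ := hcb.exists_bound_of_continuousOn hP.continuousOn
  set L : ℝ := max M |e| with hL
  have hL0 : 0 ≤ L := (abs_nonneg e).trans (le_max_right _ _)
  have hαL : ∀ w ∈ Metric.closedBall (0 : ℂ) 1, ‖α w‖ ≤ L := fun w hw =>
    (hM w hw).trans (le_max_left _ _)
  have heL : ‖(e : ℂ)‖ ≤ L := by rw [Complex.norm_real]; exact le_max_right _ _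
  obtain ⟨C₀, hC₀, hbd⟩ := hP.bound L
  set δ : ℝ := (Real.circleAverage τ 0 1 - ε ^ 2) / 8 with hδ
  have hδ0 : 0 < δ := by rw [hδ]; linarith
  obtain ⟨G, hG⟩ := exists_polynomial_abs_re_sub_le (hτc.mono hsph) hδ0
  have hGd : Differentiable ℂ fun w => G.eval w := G.differentiable
  have hGc : Continuous fun w => (G.eval w).re := Complex.continuous_re.comp hGd.continuous
  have hG0 : Real.circleAverage τ 0 1 - δ ≤ (G.eval 0).re := by
    rw [← circleAverage_re_of_differentiable hGd 0 1]
    have hi : CircleIntegrable τ 0 1 := (hτc.mono (by simpa using hsph)).circleIntegrable'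
    have := Real.circleAverage_mono (c := 0) (R := 1) (f₁ := fun w => τ w - δ)
      (f₂ := fun w => (G.eval w).re) (hi.sub (circleIntegrable_const _ _ _))
      hGc.continuousOn.circleIntegrable' (fun w hw => by
        have := (abs_le.1 (hG w (by simpa using hw))).1
        linarith)
    rwa [Real.circleAverage_fun_sub hi (circleIntegrable_const _ _ _),
      Real.circleAverage_const] at this
  obtain ⟨B', hB'⟩ := hcb.exists_bound_of_continuousOn hGc.continuousOn
  obtain ⟨s₂, hs₂, hs₂1, hcol⟩ := exists_collar
    (φ := fun w => max ((α w).im ^ 2) (max 0 ((G.eval w).re - τ w - δ + ε ^ 2))) (K := ε ^ 2 + δ)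
    (by
      have h1 : ContinuousOn (fun w => (α w).im) (Metric.closedBall 0 1) :=
        Complex.continuous_im.comp_continuousOn hP.continuousOn
      have h2 : ContinuousOn (fun w => (G.eval w).re) (Metric.closedBall 0 1) := hGc.continuousOn
      fun_prop)
    (fun w hw => by
      have h1 := sq_le_sq' (by linarith [(abs_le.1 (hε w hw)).1]) (abs_le.1 (hε w hw)).2
      have h2 := (abs_le.1 (hG w hw)).2
      have h3 := sq_nonneg ε
      refine max_lt (by linarith) (max_lt (by linarith) (by linarith)))
  refine ⟨C₀ * C₀, 4 * δ, by positivity, by positivity, fun κ hκ => ?_⟩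
  set B : ℝ := L ^ 2
  set D : ℝ := C₀ * C₀ * Real.exp (κ * (ε ^ 2 + 3 * δ)) with hD
  have hD0 : 0 < D := by positivity
  set q : ℝ := D / (C₀ * (Real.exp (κ * B) * Real.exp (κ * B'))) with hq
  have hq0 : 0 < q := by positivity
  obtain ⟨s₀, hs₀, K₁, hK₁, htiny⟩ := hP.tiny q hq0
  obtain ⟨s₁, hs₁, huc⟩ := Metric.uniformContinuousOn_iff.1
    (hcb.uniformContinuousOn_of_continuous hP.continuousOn) s₀ hs₀
  set s : ℝ := min (s₁ / 2) s₂ with hs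
  have hs0 : 0 < s := by positivity
  have hss₁ : s < s₁ := (min_le_left _ _).trans_lt (by linarith)
  have hss₂ : s ≤ s₂ := min_le_right _ _
  refine ⟨2 * L + 3 * (s₀ * K₁) / s ^ 2, by positivity, fun n R₀ hR₀ => ?_⟩
  obtain ⟨R, hRa, hRc, hRd⟩ := exists_primitive_mul_polyEval (P n)
    (differentiable_conjWeight P κ t n)
  have hR₀R : R₀ (α 0) - R₀ e = R 0 (α 0) - R 0 e := by
    have hd : ∀ b, HasDerivAt (fun b => R₀ b - R 0 b) 0 b := fun b =>
      ((hR₀ b).sub (hRd 0 b)).congr_deriv (sub_self _)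
    have := is_const_of_deriv_eq_zero (fun b => (hd b).differentiableAt)
      (fun b => (hd b).deriv) (α 0) e
    linear_combination this
  have hw : ∀ b : ℂ, ‖b‖ ≤ L → ‖conjWeight P κ t n b‖ ≤
      Real.exp (κ * (b.im ^ 2 - (b.re - t) ^ 2)) ^ n * C₀ ^ n := by
    intro b hb
    rw [conjWeight, norm_mul, norm_cexp_neg_nat_mul_sq, RCLike.norm_conj]
    gcongr
    exact hbd n 0 (by simp) _ (by rwa [RCLike.norm_conj])
  have hwB : ∀ b : ℂ, ‖b‖ ≤ L → ‖conjWeight P κ t n b‖ ≤ Real.exp (κ * B) ^ n * C₀ ^ n := by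
    intro b hb
    refine (hw b hb).trans ?_
    gcongr
    have h1 : b.im ^ 2 ≤ L ^ 2 :=
      sq_le_sq' (by linarith [neg_abs_le b.im, Complex.abs_im_le_norm b])
        ((le_abs_self _).trans ((Complex.abs_im_le_norm b).trans hb))
    nlinarith [sq_nonneg (b.re - t)]
  have hmain := norm_le_of_locally_near_analytic
    (F := fun w => (R w (α w) - R w e) * Complex.exp (n * κ * G.eval w)) (s := s)
    (η := s₀ * K₁ * D ^ n) (M := 2 * L * D ^ n) ?_ hs0 (hss₂.trans_lt hs₂1) (by positivity) ?_ ?_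
  · rw [hR₀R]
    rw [norm_mul, norm_cexp_nat_mul] at hmain
    have h1 : 0 < Real.exp (κ * (G.eval 0).re) ^ n := by positivity
    have h2 : D ^ n ≤ (C₀ * C₀ * Real.exp (-(κ * (4 * δ)))) ^ n *
        Real.exp (κ * (G.eval 0).re) ^ n := by
      rw [← mul_pow, hD, mul_assoc (C₀ * C₀), ← Real.exp_add]
      gcongr
      have : ε ^ 2 + 3 * δ ≤ -(4 * δ) + (G.eval 0).re := by linarith
      nlinarith
    have h3 : 2 * L * D ^ n + 3 * (s₀ * K₁ * D ^ n) / s ^ 2 =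
      (2 * L + 3 * (s₀ * K₁) / s ^ 2) * D ^ n := by ring
    rw [h3] at hmain
    rw [← mul_le_mul_iff_left₀ h1]
    refine hmain.trans ?_
    rw [mul_assoc]
    gcongr
  · refine ContinuousOn.mul (ContinuousOn.sub ?_ ?_) ?_
    · exact hRc.comp (continuousOn_id.prodMk hP.continuousOn) fun w hw => ⟨hw, trivial⟩
    · exact (hRa e).continuousOn
    · have := hGd.continuous
      fun_prop
  · intro v hv
    refine ⟨fun w => (R w (α v) - R w e) * Complex.exp (n * κ * G.eval w), ?_, ?_⟩
    · refine AnalyticOnNhd.mul ((hRa _).sub (hRa _)) ?_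
      have : Differentiable ℂ fun w => Complex.exp (n * κ * G.eval w) := by fun_prop
      exact fun w _ => this.analyticAt w
    · intro w hwv
      have hv' : v ∈ Metric.closedBall (0 : ℂ) 1 := by rw [mem_closedBall_zero_iff]; linarith
      have hw' : w ∈ Metric.closedBall (0 : ℂ) 1 := by
        have h1 : dist w v ≤ s := hwv
        have h2 := dist_triangle w v 0
        rw [dist_zero_right v] at h2
        rw [Metric.mem_closedBall]; linarith
      have hd : ‖α w - α v‖ ≤ s₀ := by
        rw [← dist_eq_norm]
        exact (huc w hw' v hv' (lt_of_le_of_lt hwv hss₁)).le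
      rw [← sub_mul, sub_sub_sub_cancel_right, norm_mul, norm_cexp_nat_mul]
      have h1 : ‖R w (α w) - R w (α v)‖ ≤
          (Real.exp (κ * B) ^ n * C₀ ^ n * (K₁ * q ^ n)) * ‖α w - α v‖ := by
        refine Convex.norm_image_sub_le_of_norm_hasDerivWithin_le
          (s := Metric.closedBall (α w) s₀ ∩ Metric.closedBall 0 L)
          (fun b _ => (hRd w b).hasDerivWithinAt) (fun b hb => ?_)
          ((convex_closedBall _ _).inter (convex_closedBall _ _)) ?_ ?_
        · rw [norm_mul]
          have hb1 : ‖b - α w‖ ≤ s₀ := by simpa [dist_eq_norm] using hb.1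
          have hb2 : ‖b‖ ≤ L := by simpa using hb.2
          gcongr
          · exact hwB b hb2
          · exact htiny n w hw' b hb1
        · refine ⟨?_, by simpa using hαL v hv'⟩
          rwa [Metric.mem_closedBall, dist_comm, dist_eq_norm]
        · exact ⟨Metric.mem_closedBall_self hs₀.le, by simpa using hαL w hw'⟩
      have h2 : Real.exp (κ * (G.eval w).re) ≤ Real.exp (κ * B') := by
        gcongr
        exact (le_abs_self _).trans (hB' w hw')
      calc ‖R w (α w) - R w (α v)‖ * Real.exp (κ * (G.eval w).re) ^ n
          ≤ ((Real.exp (κ * B) ^ n * C₀ ^ n * (K₁ * q ^ n)) * s₀) * Real.exp (κ * B') ^ n := by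
            gcongr
            exact h1.trans (by gcongr)
        _ = s₀ * K₁ * (Real.exp (κ * B) * C₀ * q * Real.exp (κ * B')) ^ n := by
            simp only [mul_pow]; ring
        _ = s₀ * K₁ * D ^ n := by
            congr 2
            rw [hq]; field_simp
  · intro w hw1 hw2
    have hw' : w ∈ Metric.closedBall (0 : ℂ) 1 := by simpa using hw2
    have hc := hcol w (by linarith) hw2
    have hc1 : (α w).im ^ 2 < ε ^ 2 + δ := (max_lt_iff.1 hc).1
    have hc2 : (G.eval w).re - τ w - δ + ε ^ 2 < ε ^ 2 + δ :=
      (max_lt_iff.1 (max_lt_iff.1 hc).2).2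
    rw [norm_mul, norm_cexp_nat_mul]
    have h1 : ‖R w (α w) - R w e‖ ≤
        (Real.exp (κ * (ε ^ 2 + δ - τ w)) ^ n * C₀ ^ n * C₀ ^ n) * ‖α w - e‖ := by
      refine Convex.norm_image_sub_le_of_norm_hasDerivWithin_le (s := segment ℝ (e : ℂ) (α w))
        (fun b _ => (hRd w b).hasDerivWithinAt) (fun b hb => ?_)
        (convex_segment _ _) (left_mem_segment _ _ _) (right_mem_segment _ _ _)
      have hb2 : ‖b‖ ≤ L := by
        have := (convex_closedBall (0 : ℂ) L).segment_subset (x := (e : ℂ)) (y := α w)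
          (by simpa using heL) (by simpa using hαL w hw') hb
        simpa using this
      rw [norm_mul]
      gcongr
      · refine (hw b hb2).trans ?_
        rw [segment_eq_image'] at hb
        obtain ⟨θ, hθ, rfl⟩ := hb
        gcongr
        · simp only [Complex.add_im, Complex.ofReal_im, Complex.real_smul, Complex.im_ofReal_mul,
            Complex.sub_im]
          have : θ ^ 2 ≤ 1 := pow_le_one₀ hθ.1 hθ.2
          nlinarith [sq_nonneg (α w).im]
        · simpa using hτ w hw' θ hθ
      · exact hbd n w hw' b hb2
    have h5 : ‖α w - e‖ ≤ 2 * L := (norm_sub_le _ _).trans (by linarith [hαL w hw'])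
    calc ‖R w (α w) - R w e‖ * Real.exp (κ * (G.eval w).re) ^ n
        ≤ ((Real.exp (κ * (ε ^ 2 + δ - τ w)) ^ n * C₀ ^ n * C₀ ^ n) * (2 * L)) *
          Real.exp (κ * (τ w + 2 * δ)) ^ n := by
          gcongr
          · exact h1.trans (by gcongr)
          · linarith
      _ = 2 * L * (C₀ * C₀ * (Real.exp (κ * (ε ^ 2 + δ - τ w)) *
            Real.exp (κ * (τ w + 2 * δ)))) ^ n := by
          simp only [mul_pow]; ring
      _ = 2 * L * D ^ n := by
          rw [← Real.exp_add, hD]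
          congr 4
          ring

theorem ae_forall_exists_le_mul_pow {h : ℕ → ℝ → ℝ} (hc : ∀ n, Continuous (h n))
    (h0 : ∀ n x, 0 ≤ h n x) {a b : ℝ} (hab : a ≤ b)
    (hi : ∀ q : ℝ, 0 < q → ∃ K : ℝ, ∀ n, ∫ x in a..b, h n x ≤ K * q ^ n) :
    ∀ᵐ x ∂(MeasureTheory.volume.restrict (Set.Ioc a b)),
      ∀ q : ℝ, 0 < q → ∃ C : ℝ, ∀ n, h n x ≤ C * q ^ n := by
  have key : ∀ m : ℕ, ∀ᵐ x ∂(MeasureTheory.volume.restrict (Set.Ioc a b)),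
      ∃ C : ℝ, ∀ n, h n x ≤ C * (1 / ((m : ℝ) + 1)) ^ n := by
    intro m
    set q : ℝ := 1 / ((m : ℝ) + 1) with hq
    have hq0 : 0 < q := by positivity
    obtain ⟨K, hK⟩ := hi (q / 2) (by positivity)
    have hm : ∀ n, Measurable fun x => ENNReal.ofReal (h n x / q ^ n) := fun n =>
      (ENNReal.continuous_ofReal.comp ((hc n).div_const _)).measurable
    have hlt : ∫⁻ x in Set.Ioc a b, ∑' n, ENNReal.ofReal (h n x / q ^ n) ≠ ⊤ := by
      rw [MeasureTheory.lintegral_tsum fun n => (hm n).aemeasurable]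
      refine ne_top_of_le_ne_top ?_ (ENNReal.tsum_le_tsum (g := fun n : ℕ =>
        ENNReal.ofReal (K * (1 / 2) ^ n)) fun n => ?_)
      · exact Summable.tsum_ofReal_ne_top
          ((summable_geometric_of_lt_one (by norm_num) (by norm_num)).mul_left K)
      · rw [← MeasureTheory.ofReal_integral_eq_lintegral_ofReal]
        · refine ENNReal.ofReal_le_ofReal ?_
          rw [← intervalIntegral.integral_of_le hab, intervalIntegral.integral_div,
            div_le_iff₀ (by positivity)]
          refine (hK n).trans_eq ?_
          rw [mul_assoc, ← mul_pow]
          congr 2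
          ring
        · exact (((hc n).div_const _).continuousOn.integrableOn_Icc).mono_set
            Set.Ioc_subset_Icc_self
        · exact Eventually.of_forall fun x => div_nonneg (h0 n x) (by positivity)
    filter_upwards [MeasureTheory.ae_lt_top (Measurable.tsum hm) hlt] with x hx
    refine ⟨(∑' n, ENNReal.ofReal (h n x / q ^ n)).toReal, fun n => ?_⟩
    rw [← div_le_iff₀ (by positivity)]
    have h1 := ENNReal.le_tsum (f := fun n => ENNReal.ofReal (h n x / q ^ n)) n
    rwa [ENNReal.ofReal_le_iff_le_toReal hx.ne] at h1
  filter_upwards [MeasureTheory.ae_all_iff.2 key] with x hx q hq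
  obtain ⟨m, hm⟩ := exists_nat_one_div_lt hq
  obtain ⟨C, hC⟩ := hx m
  have hC0 : 0 ≤ C := by simpa using (h0 0 x).trans (hC 0)
  exact ⟨C, fun n => (hC n).trans (by gcongr)⟩

theorem conjWeight_mul_polyEval_ofReal (P : ℕ → Polynomial discAnalytic) (κ t : ℝ) (n : ℕ) (x : ℝ) :
    conjWeight P κ t n x * polyEval (P n) 0 x =
      ((Real.exp (-(κ * (x - t) ^ 2)) ^ n * ‖polyEval (P n) 0 x‖ ^ 2 : ℝ) : ℂ) := by
  rw [conjWeight, Complex.conj_ofReal, mul_assoc, Complex.conj_mul', ← Real.exp_nat_mul]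
  push_cast
  congr 2
  ring

theorem TinyFamily.not_lt_and_lt {P : ℕ → Polynomial discAnalytic} {α : ℂ → ℂ}
    (hP : TinyFamily P α) {ε : ℝ} (hε : ∀ w ∈ Metric.sphere (0 : ℂ) 1, |(α w).im| ≤ ε) (t : ℝ) :
    ¬ (ε ^ 2 < Real.circleAverage (fun w => (max (t - (α w).re) 0) ^ 2) 0 1 ∧
      ε ^ 2 < Real.circleAverage (fun w => (max ((α w).re - t) 0) ^ 2) 0 1) := by
  rintro ⟨h₁, h₂⟩
  obtain ⟨M, hM⟩ := (isCompact_closedBall (0 : ℂ) 1).exists_bound_of_continuousOn hP.continuousOn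
  set L : ℝ := max M |t| + 1 with hL
  have htL : |t| ≤ L - 1 := by rw [hL]; linarith [le_max_right M |t|]
  have hαL : ∀ w ∈ Metric.closedBall (0 : ℂ) 1, |(α w).re| ≤ L := fun w hw =>
    (Complex.abs_re_le_norm _).trans ((hM w hw).trans (by rw [hL]; linarith [le_max_left M |t|]))
  have hL0 : 0 ≤ L := by linarith [abs_nonneg t]
  have hrec : ContinuousOn (fun w => (α w).re) (Metric.closedBall 0 1) :=
    Complex.continuous_re.comp_continuousOn hP.continuousOn
  obtain ⟨C₁, c₁, hC₁, hc₁, H₁⟩ := hP.norm_primitive_sub_le (e := -L) (t := t) hε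
    (by fun_prop) (fun w hw θ hθ => by
      have h3 := abs_le.1 (hαL w hw)
      rcases le_total (t - (α w).re) 0 with h | h
      · rw [max_eq_right h, zero_pow two_ne_zero]; positivity
      · rw [max_eq_left h, ← neg_sq (-L + _ - t)]
        gcongr
        nlinarith [hθ.1, hθ.2]) h₁
  obtain ⟨C₂, c₂, hC₂, hc₂, H₂⟩ := hP.norm_primitive_sub_le (e := L) (t := t) hε
    (by fun_prop) (fun w hw θ hθ => by
      have h3 := abs_le.1 (hαL w hw)
      rcases le_total ((α w).re - t) 0 with h | h
      · rw [max_eq_right h, zero_pow two_ne_zero]; positivity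
      · rw [max_eq_left h]
        gcongr
        nlinarith [hθ.1, hθ.2]) h₂
  set C := max C₁ C₂ with hC
  set c := min c₁ c₂ with hc
  have hC0 : 0 < C := lt_max_of_lt_left hC₁
  have hc0 : 0 < c := lt_min hc₁ hc₂
  set η : ℝ := min 1 (c / 2) with hη
  have hη0 : 0 < η := by positivity
  have hη1 : η ≤ 1 := min_le_left _ _
  have hη2 : η ^ 2 ≤ c / 2 := by
    have : η ≤ c / 2 := min_le_right _ _
    nlinarith
  have htL' := abs_le.1 htL
  set p : ℕ → ℝ → ℝ := fun n x => ‖polyEval (P n) 0 x‖ ^ 2 with hp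
  have hpc : ∀ n, Continuous (p n) := fun n => by
    have := (differentiable_polyEval (P n) 0).continuous
    fun_prop
  have hp0 : ∀ n x, 0 ≤ p n x := fun n x => by positivity
  have hbound : ∀ κ : ℝ, 0 < κ → ∃ K : ℝ, 0 < K ∧ ∀ n,
      ∫ x in (t - η)..(t + η), p n x ≤ K * (C * Real.exp (-(κ * (c / 2)))) ^ n := by
    intro κ hκ
    obtain ⟨K₁, hK₁, H₁⟩ := H₁ κ hκ
    obtain ⟨K₂, hK₂, H₂⟩ := H₂ κ hκ
    refine ⟨K₁ + K₂, by positivity, fun n => ?_⟩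
    obtain ⟨R, -, -, hR⟩ := exists_primitive_mul_polyEval (P n) (differentiable_conjWeight P κ t n)
    have e₁ := H₁ n (R 0) (hR 0)
    have e₂ := H₂ n (R 0) (hR 0)
    have hgc : Continuous fun x : ℝ => Real.exp (-(κ * (x - t) ^ 2)) ^ n * p n x := by
      have := hpc n
      fun_prop
    have hpeak : ∫ x in (-L)..L, Real.exp (-(κ * (x - t) ^ 2)) ^ n * p n x =
        ‖R 0 (L : ℝ) - R 0 ((-L : ℝ) : ℂ)‖ := by
      have h3 : ∫ x : ℝ in (-L)..L, conjWeight P κ t n x * polyEval (P n) 0 x =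
          R 0 (L : ℝ) - R 0 ((-L : ℝ) : ℂ) := by
        refine intervalIntegral.integral_eq_sub_of_hasDerivAt
          (f := fun x : ℝ => R 0 (x : ℂ)) (fun x _ => (hR 0 x).comp_ofReal) ?_
        have h4 := (differentiable_conjWeight P κ t n).continuous
        have h5 := (differentiable_polyEval (P n) 0).continuous
        exact Continuous.intervalIntegrable (by fun_prop) _ _
      rw [← h3]
      simp only [conjWeight_mul_polyEval_ofReal]
      rw [intervalIntegral.integral_ofReal, Complex.norm_real, Real.norm_of_nonneg]
      exact intervalIntegral.integral_nonneg (by linarith) fun x _ => by positivity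
    have hle : ∫ x in (t - η)..(t + η), Real.exp (-(κ * (c / 2))) ^ n * p n x ≤
        ‖R 0 (L : ℝ) - R 0 ((-L : ℝ) : ℂ)‖ := by
      rw [← hpeak]
      calc ∫ x in (t - η)..(t + η), Real.exp (-(κ * (c / 2))) ^ n * p n x
          ≤ ∫ x in (t - η)..(t + η), Real.exp (-(κ * (x - t) ^ 2)) ^ n * p n x := by
            refine intervalIntegral.integral_mono_on (by linarith)
              (((hpc n).const_mul _).intervalIntegrable _ _) (hgc.intervalIntegrable _ _)
              fun x hx => ?_
            have : (x - t) ^ 2 ≤ η ^ 2 := sq_le_sq' (by linarith [hx.1]) (by linarith [hx.2])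
            gcongr
            linarith
        _ ≤ _ := by
            refine intervalIntegral.integral_mono_interval (by linarith) (by linarith)
              (by linarith) (Eventually.of_forall fun x => ?_) (hgc.intervalIntegrable _ _)
            have := hp0 n x
            simp only [Pi.zero_apply]
            positivity
    rw [intervalIntegral.integral_const_mul] at hle
    have hsum : ‖R 0 (L : ℝ) - R 0 ((-L : ℝ) : ℂ)‖ ≤
        (K₁ + K₂) * (C * Real.exp (-(κ * c))) ^ n := by
      have f₁ : (C₁ * Real.exp (-(κ * c₁))) ^ n ≤ (C * Real.exp (-(κ * c))) ^ n := by
        gcongr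
        · exact le_max_left _ _
        · exact min_le_left _ _
      have f₂ : (C₂ * Real.exp (-(κ * c₂))) ^ n ≤ (C * Real.exp (-(κ * c))) ^ n := by
        gcongr
        · exact le_max_right _ _
        · exact min_le_right _ _
      calc ‖R 0 (L : ℝ) - R 0 ((-L : ℝ) : ℂ)‖
          = ‖(R 0 (α 0) - R 0 ((-L : ℝ) : ℂ)) - (R 0 (α 0) - R 0 (L : ℝ))‖ := by
            congr 1; ring
        _ ≤ _ := norm_sub_le _ _
        _ ≤ K₁ * (C * Real.exp (-(κ * c))) ^ n + K₂ * (C * Real.exp (-(κ * c))) ^ n :=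
            add_le_add (e₁.trans (by gcongr)) (e₂.trans (by gcongr))
        _ = _ := by ring
    have h6 : (0 : ℝ) < Real.exp (-(κ * (c / 2))) ^ n := by positivity
    rw [← mul_le_mul_iff_right₀ h6]
    refine (hle.trans hsum).trans_eq ?_
    rw [mul_left_comm, ← mul_pow, mul_left_comm _ C, ← Real.exp_add]
    congr 4
    ring
  have hall : ∀ q : ℝ, 0 < q → ∃ K : ℝ, ∀ n, ∫ x in (t - η)..(t + η), p n x ≤ K * q ^ n := by
    intro q hq
    have hlim : Tendsto (fun κ : ℝ => C * Real.exp (-(κ * (c / 2)))) atTop (nhds (C * 0)) :=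
      (Real.tendsto_exp_neg_atTop_nhds_zero.comp
        (tendsto_id.atTop_mul_const (by positivity : 0 < c / 2))).const_mul C
    rw [mul_zero] at hlim
    obtain ⟨κ, hκ, hκ0⟩ := ((hlim.eventually (gt_mem_nhds hq)).and (eventually_gt_atTop 0)).exists
    obtain ⟨K, hK, h⟩ := hbound κ hκ0
    exact ⟨K, fun n => (h n).trans (by gcongr)⟩
  have hae := ae_forall_exists_le_mul_pow hpc hp0 (a := t - η) (b := t + η) (by linarith) hall
  have hnull := (hP.countable.preimage Complex.ofReal_injective).ae_notMem
    (MeasureTheory.volume.restrict (Set.Ioc (t - η) (t + η)))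
  have hfalse : ∀ᵐ x ∂(MeasureTheory.volume.restrict (Set.Ioc (t - η) (t + η))), False := by
    filter_upwards [hae, hnull] with x hx hx'
    refine hx' fun q hq => ?_
    obtain ⟨K, hK⟩ := hx (q ^ 2) (by positivity)
    have hK0 : 0 ≤ K := by simpa using (hp0 0 x).trans (hK 0)
    refine ⟨K + 1, fun n => ?_⟩
    have h7 : ‖polyEval (P n) 0 x‖ ^ 2 ≤ ((K + 1) * q ^ n) ^ 2 := by
      refine (hK n).trans ?_
      rw [mul_pow, ← pow_mul, ← pow_mul, mul_comm n 2]
      gcongr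
      nlinarith
    exact le_of_sq_le_sq h7 (by positivity)
  rw [eventually_false_iff_eq_bot, MeasureTheory.ae_eq_bot, MeasureTheory.Measure.restrict_eq_zero,
    Real.volume_Ioc, ENNReal.ofReal_eq_zero] at hfalse
  linarith

theorem exists_sq_circleAverage_le {α : ℂ → ℂ} (hα : ContinuousOn α (Metric.closedBall 0 1)) {ε : ℝ}
    (h : ∀ t : ℝ, ¬ (ε ^ 2 < Real.circleAverage (fun w => (max (t - (α w).re) 0) ^ 2) 0 1 ∧
      ε ^ 2 < Real.circleAverage (fun w => (max ((α w).re - t) 0) ^ 2) 0 1)) :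
    ∃ t : ℝ, Real.circleAverage (fun w => ((α w).re - t) ^ 2) 0 1 ≤ 2 * ε ^ 2 := by
  have hsub : Metric.sphere (0 : ℂ) |1| ⊆ Metric.closedBall 0 1 := by
    rw [abs_one]; exact Metric.sphere_subset_closedBall
  have huc : ContinuousOn (fun w => (α w).re) (Metric.sphere 0 |1|) :=
    Complex.continuous_re.comp_continuousOn (hα.mono hsub)
  have hcirc : Continuous fun θ : ℝ => (α (circleMap 0 1 θ)).re :=
    huc.comp_continuous (continuous_circleMap 0 1) fun θ => circleMap_mem_sphere' 0 1 θ
  have hcirc' : Continuous fun p : ℝ × ℝ => (α (circleMap 0 1 p.2)).re := hcirc.comp continuous_snd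
  set A : ℝ → ℝ := fun t => Real.circleAverage (fun w => (max (t - (α w).re) 0) ^ 2) 0 1 with hA
  set B : ℝ → ℝ := fun t => Real.circleAverage (fun w => (max ((α w).re - t) 0) ^ 2) 0 1 with hB
  have hAc : Continuous A := by
    simp only [hA, Real.circleAverage_def]
    have := intervalIntegral.continuous_parametric_intervalIntegral_of_continuous'
      (μ := MeasureTheory.volume) (f := fun t θ => (max (t - (α (circleMap 0 1 θ)).re) 0) ^ 2)
      (show Continuous fun p : ℝ × ℝ => (max (p.1 - (α (circleMap 0 1 p.2)).re) 0) ^ 2 by fun_prop)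
      0 (2 * Real.pi)
    exact this.const_smul (2 * Real.pi)⁻¹
  have hBc : Continuous B := by
    simp only [hB, Real.circleAverage_def]
    have := intervalIntegral.continuous_parametric_intervalIntegral_of_continuous'
      (μ := MeasureTheory.volume) (f := fun t θ => (max ((α (circleMap 0 1 θ)).re - t) 0) ^ 2)
      (show Continuous fun p : ℝ × ℝ => (max ((α (circleMap 0 1 p.2)).re - p.1) 0) ^ 2 by fun_prop)
      0 (2 * Real.pi)
    exact this.const_smul (2 * Real.pi)⁻¹
  have hiA : ∀ t : ℝ, CircleIntegrable (fun w => (max (t - (α w).re) 0) ^ 2) 0 1 := fun t =>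
    ContinuousOn.circleIntegrable' (by fun_prop)
  have hiB : ∀ t : ℝ, CircleIntegrable (fun w => (max ((α w).re - t) 0) ^ 2) 0 1 := fun t =>
    ContinuousOn.circleIntegrable' (by fun_prop)
  obtain ⟨L, hL⟩ := (isCompact_sphere (0 : ℂ) |1|).exists_bound_of_continuousOn huc
  have hL0 : 0 ≤ L := (norm_nonneg _).trans (hL 1 (by simp))
  have hA0 : ∀ t, 0 ≤ A t := fun t => Real.circleAverage_nonneg_of_nonneg fun w _ => by positivity
  have hB0 : ∀ t, 0 ≤ B t := fun t => Real.circleAverage_nonneg_of_nonneg fun w _ => by positivity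
  have hAL : A (-L) = 0 := by
    refine Real.circleAverage_const_on_circle fun w hw => ?_
    have := abs_le.1 (hL w hw)
    rw [max_eq_right (by linarith), zero_pow two_ne_zero]
  have hBL : B L = 0 := by
    refine Real.circleAverage_const_on_circle fun w hw => ?_
    have := abs_le.1 (hL w hw)
    rw [max_eq_right (by linarith), zero_pow two_ne_zero]
  obtain ⟨t, -, ht⟩ := intermediate_value_Icc (show -L ≤ L by linarith)
    (hAc.sub hBc).continuousOn (show (0 : ℝ) ∈ _ from
      ⟨by rw [Pi.sub_apply, hAL]; linarith [hB0 (-L)],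
        by rw [Pi.sub_apply, hBL]; linarith [hA0 L]⟩)
  have hAB : A t = B t := sub_eq_zero.1 ht
  have hle : A t ≤ ε ^ 2 := by
    by_contra hcon
    exact h t ⟨not_le.1 hcon, lt_of_lt_of_eq (not_le.1 hcon) hAB⟩
  refine ⟨t, ?_⟩
  have hsum : Real.circleAverage (fun w => ((α w).re - t) ^ 2) 0 1 = A t + B t := by
    simp only [hA, hB]
    rw [← Real.circleAverage_fun_add (hiA t) (hiB t)]
    congr 1
    funext w
    rcases le_total (t - (α w).re) 0 with h | h
    · rw [max_eq_right h, max_eq_left (by linarith)]; ring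
    · rw [max_eq_left h, max_eq_right (by linarith)]; ring
  rw [hsum]
  linarith

theorem TinyFamily.circleAverage_mul_eq_zero {P : ℕ → Polynomial discAnalytic} {g : ℂ → ℂ}
    (hP : TinyFamily P g) : Real.circleAverage (fun w => w * g w) 0 1 = 0 := by
  have hsub : Metric.sphere (0 : ℂ) |1| ⊆ Metric.closedBall 0 1 := by
    rw [abs_one]; exact Metric.sphere_subset_closedBall
  have main : ∀ ε : ℝ, 0 < ε → ‖Real.circleAverage (fun w => w * g w) 0 1‖ ≤ 4 * ε := by
    intro ε hε
    obtain ⟨G, hG⟩ := exists_polynomial_abs_re_sub_le (τ := fun w => (g w).im)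
      (Complex.continuous_im.comp_continuousOn
        (hP.continuousOn.mono Metric.sphere_subset_closedBall)) hε
    have hGd : Differentiable ℂ fun w => Complex.I * G.eval w :=
      G.differentiable.const_mul Complex.I
    set α : ℂ → ℂ := fun w => g w - Complex.I * G.eval w with hα
    have hPα := hP.sub ⟨fun w => Complex.I * G.eval w, fun w _ => hGd.analyticAt w⟩
    change TinyFamily _ α at hPα
    have him : ∀ w ∈ Metric.sphere (0 : ℂ) 1, |(α w).im| ≤ ε := by
      intro w hw
      have := hG w hw
      rw [abs_sub_comm] at this
      simpa [hα] using this
    obtain ⟨t, ht⟩ := exists_sq_circleAverage_le hPα.continuousOn (hPα.not_lt_and_lt him)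
    have hαc : ContinuousOn α (Metric.sphere 0 |1|) := hPα.continuousOn.mono hsub
    have hrec : ContinuousOn (fun w => (α w).re) (Metric.sphere 0 |1|) :=
      Complex.continuous_re.comp_continuousOn hαc
    have hd : Differentiable ℂ fun w : ℂ => w * (Complex.I * G.eval w + t) := by fun_prop
    have hz : Real.circleAverage (fun w : ℂ => w * (Complex.I * G.eval w + t)) 0 1 = 0 := by
      rw [hd.diffContOnCl.circleAverage, zero_mul]
    have hsplit : Real.circleAverage (fun w => w * g w) 0 1 =
        Real.circleAverage (fun w => w * (α w - t)) 0 1 := by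
      rw [← add_zero (Real.circleAverage (fun w => w * (α w - t)) 0 1)]
      refine Eq.trans ?_ (congrArg _ hz)
      rw [← Real.circleAverage_fun_add]
      · congr 1; funext w; simp only [hα]; ring
      · exact ContinuousOn.circleIntegrable' (by fun_prop)
      · exact hd.continuous.continuousOn.circleIntegrable'
    rw [hsplit]
    refine (norm_circleAverage_le_circleAverage_norm _ _ _).trans ?_
    have hi : CircleIntegrable (fun w => ε⁻¹ * ((α w).re - t) ^ 2) 0 1 :=
      ContinuousOn.circleIntegrable' (by fun_prop)
    have hi' : CircleIntegrable (fun w => ((α w).re - t) ^ 2) 0 1 :=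
      ContinuousOn.circleIntegrable' (by fun_prop)
    have hbound : Real.circleAverage (fun w => ‖w * (α w - t)‖) 0 1 ≤
        Real.circleAverage (fun w => ε⁻¹ * ((α w).re - t) ^ 2 + 2 * ε) 0 1 := by
      refine Real.circleAverage_mono (ContinuousOn.circleIntegrable' (by fun_prop))
        (hi.add (circleIntegrable_const _ _ _)) fun w hw => ?_
      rw [abs_one] at hw
      rw [norm_mul, mem_sphere_zero_iff_norm.1 hw, one_mul]
      have h1 := Complex.norm_le_abs_re_add_abs_im (α w - t)
      have h2 := him w hw
      simp only [Complex.sub_re, Complex.sub_im, Complex.ofReal_re, Complex.ofReal_im,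
        sub_zero] at h1
      have h3 : |(α w).re - t| ≤ ε⁻¹ * ((α w).re - t) ^ 2 + ε := by
        rw [← sq_abs, ← mul_le_mul_iff_right₀ hε, mul_add, ← mul_assoc, mul_inv_cancel₀ hε.ne',
          one_mul]
        nlinarith [sq_nonneg (|(α w).re - t| - ε), abs_nonneg ((α w).re - t)]
      linarith
    refine hbound.trans ?_
    rw [Real.circleAverage_fun_add hi (circleIntegrable_const _ _ _), Real.circleAverage_const]
    have h4 : Real.circleAverage (fun w => ε⁻¹ * ((α w).re - t) ^ 2) 0 1 =
        ε⁻¹ * Real.circleAverage (fun w => ((α w).re - t) ^ 2) 0 1 :=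
      Real.circleAverage_fun_smul (a := ε⁻¹) (f := fun w => ((α w).re - t) ^ 2)
    rw [h4]
    have h5 : ε⁻¹ * Real.circleAverage (fun w => ((α w).re - t) ^ 2) 0 1 ≤ 2 * ε := by
      rw [inv_mul_le_iff₀ hε]
      linarith
    linarith
  have : ‖Real.circleAverage (fun w => w * g w) 0 1‖ ≤ 0 := by
    refine le_of_forall_pos_le_add fun ε hε => ?_
    have := main (ε / 4) (by positivity)
    linarith
  exact norm_le_zero_iff.1 this

/-- The coefficients of the power series `1 / (1 - X * ∑ e k * X ^ k)`. -/
def geomCoeff {R : Type*} [CommRing R] (e : ℕ → R) : ℕ → R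
  | 0 => 1
  | n + 1 => ∑ k : Fin (n + 1), e k * geomCoeff e (n - k)

theorem geomCoeff_zero {R : Type*} [CommRing R] (e : ℕ → R) : geomCoeff e 0 = 1 := by
  rw [geomCoeff]

theorem geomCoeff_succ {R : Type*} [CommRing R] (e : ℕ → R) (n : ℕ) :
    geomCoeff e (n + 1) = ∑ k ∈ Finset.range (n + 1), e k * geomCoeff e (n - k) := by
  rw [geomCoeff, Fin.sum_univ_eq_sum_range (fun k => e k * geomCoeff e (n - k))]

theorem map_geomCoeff {R R' : Type*} [CommRing R] [CommRing R'] (φ : R →+* R') (e : ℕ → R) (n : ℕ) :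
    φ (geomCoeff e n) = geomCoeff (fun k => φ (e k)) n := by
  induction n using Nat.strong_induction_on with
  | _ n ih =>
    cases n with
    | zero => rw [geomCoeff_zero, geomCoeff_zero, map_one]
    | succ n =>
      rw [geomCoeff_succ, geomCoeff_succ, map_sum]
      refine Finset.sum_congr rfl fun k hk => ?_
      rw [map_mul, ih _ (by omega)]

theorem eq_geomCoeff {R : Type*} [CommRing R] {e d : ℕ → R} (h0 : d 0 = 1)
    (hd : ∀ n, d (n + 1) = ∑ k ∈ Finset.range (n + 1), e k * d (n - k)) (n : ℕ) :
    d n = geomCoeff e n := by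
  induction n using Nat.strong_induction_on with
  | _ n ih =>
    cases n with
    | zero => rw [geomCoeff_zero, h0]
    | succ n =>
      rw [geomCoeff_succ, hd]
      exact Finset.sum_congr rfl fun k hk => by rw [ih _ (by omega)]

theorem norm_geomCoeff_le {e : ℕ → ℂ} {N : ℝ} (hN : ∀ k, ‖e k‖ ≤ N) (n : ℕ) :
    ‖geomCoeff e n‖ ≤ (N + 1) ^ n := by
  have hN0 : 0 ≤ N := (norm_nonneg _).trans (hN 0)
  induction n using Nat.strong_induction_on with
  | _ n ih =>
    cases n with
    | zero => simp [geomCoeff_zero]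
    | succ n =>
      rw [geomCoeff_succ]
      calc ‖∑ k ∈ Finset.range (n + 1), e k * geomCoeff e (n - k)‖
          ≤ ∑ k ∈ Finset.range (n + 1), N * (N + 1) ^ (n - k) := by
            refine norm_sum_le_of_le _ fun k hk => ?_
            rw [norm_mul]
            gcongr
            · exact hN k
            · exact ih _ (by omega)
        _ = ∑ k ∈ Finset.range (n + 1), N * (N + 1) ^ k :=
            Finset.sum_range_reflect (fun k => N * (N + 1) ^ k) (n + 1) ▸ by simp
        _ = (N + 1) ^ (n + 1) - 1 := by
            rw [← Finset.mul_sum, ← geom_sum_mul (N + 1)]; ring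
        _ ≤ _ := by linarith

/-- The Taylor coefficients at `0` of the first variable. -/
noncomputable def fiberCoeff (F : ℂ × ℂ → ℂ) (k : ℕ) (w : ℂ) : ℂ :=
  iteratedDeriv k (fun z => F (z, w)) 0 / k.factorial

theorem differentiable_fiber {F : ℂ × ℂ → ℂ} {V : Set ℂ} (hF : AnalyticOnNhd ℂ F (Set.univ ×ˢ V))
    {w : ℂ} (hw : w ∈ V) : Differentiable ℂ fun z => F (z, w) := by
  intro z
  exact (hF (z, w) ⟨trivial, hw⟩).differentiableAt.comp z
    (differentiableAt_id.prodMk (differentiableAt_const w))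

theorem exists_iteratedDeriv_fiber {F : ℂ × ℂ → ℂ} {V : Set ℂ}
    (hF : AnalyticOnNhd ℂ F (Set.univ ×ˢ V)) (k : ℕ) :
    ∃ Fk : ℂ × ℂ → ℂ, AnalyticOnNhd ℂ Fk (Set.univ ×ˢ V) ∧
      ∀ w ∈ V, iteratedDeriv k (fun z => F (z, w)) = fun z => Fk (z, w) := by
  induction k with
  | zero => exact ⟨F, hF, fun w _ => iteratedDeriv_zero⟩
  | succ k ih =>
    obtain ⟨Fk, hFk, h⟩ := ih
    refine ⟨fun p => fderiv ℂ Fk p (1, 0), fun p hp => ?_, fun w hw => ?_⟩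
    · exact (ContinuousLinearMap.apply ℂ ℂ ((1, 0) : ℂ × ℂ)).analyticAt _ |>.comp (hFk.fderiv p hp)
    · rw [iteratedDeriv_succ, h w hw]
      funext z
      have h1 := (hFk (z, w) ⟨trivial, hw⟩).differentiableAt.hasFDerivAt
      have h2 : HasDerivAt (fun z : ℂ => (z, w)) (1, 0) z :=
        (hasDerivAt_id z).prodMk (hasDerivAt_const z w)
      exact (h1.comp_hasDerivAt z h2).deriv

theorem analyticOnNhd_fiberCoeff {F : ℂ × ℂ → ℂ} {U : Set ℂ} (hU : IsOpen U)
    (hF : AnalyticOnNhd ℂ F (Set.univ ×ˢ U)) (k : ℕ) : AnalyticOnNhd ℂ (fiberCoeff F k) U := by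
  obtain ⟨Fk, hFk, h⟩ := exists_iteratedDeriv_fiber hF k
  intro w hw
  have h1 : AnalyticAt ℂ (fun w => Fk (0, w) / (k.factorial : ℂ)) w :=
    ((hFk (0, w) ⟨trivial, hw⟩).comp (AnalyticAt.prod analyticAt_const analyticAt_id)).div_const
  refine h1.congr ?_
  filter_upwards [hU.mem_nhds hw] with w' hw'
  rw [fiberCoeff, h w' hw']

theorem norm_iteratedDeriv_div_factorial_le {h : ℂ → ℂ} {r M : ℝ} (hr : 0 < r)
    (hd : DifferentiableOn ℂ h (Metric.closedBall 0 r)) (hM : ∀ z ∈ Metric.sphere (0 : ℂ) r, ‖h z‖ ≤ M)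
    (n : ℕ) : ‖iteratedDeriv n h 0 / n.factorial‖ ≤ M / r ^ n := by
  have h1 := Complex.norm_iteratedDeriv_le_of_forall_mem_sphere_norm_le (c := 0) n hr
    (hd.diffContOnCl_ball subset_rfl) hM
  rw [norm_div, Complex.norm_natCast, div_le_iff₀ (by positivity)]
  exact h1.trans_eq (by ring)

/-- The Taylor coefficients of a geometric series. -/
theorem iteratedDeriv_one_div_one_sub {f : ℂ → ℂ} (hf : AnalyticAt ℂ f 0) (h0 : f 0 = 0) (n : ℕ) :
    iteratedDeriv n (fun z => (1 - f z)⁻¹) 0 / n.factorial =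
      geomCoeff (fun k => iteratedDeriv (k + 1) f 0 / (k + 1).factorial) n := by
  set h : ℂ → ℂ := fun z => (1 - f z)⁻¹ with hh
  have hne : ∀ᶠ z in nhds (0 : ℂ), 1 - f z ≠ 0 :=
    (continuousAt_const.sub hf.continuousAt).eventually_ne (by simp [h0])
  have hha : AnalyticAt ℂ h 0 := (analyticAt_const.sub hf).inv (by simp [h0])
  refine eq_geomCoeff (d := fun n => iteratedDeriv n h 0 / n.factorial) (by simp [hh, h0])
    (fun m => ?_) n
  have heq : h =ᶠ[nhds 0] fun z => 1 + f z * h z := by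
    filter_upwards [hne] with z hz
    simp only [hh]
    field_simp
    ring
  have h1 : iteratedDeriv (m + 1) h 0 = iteratedDeriv (m + 1) (f * h) 0 := by
    rw [heq.iteratedDeriv_eq, iteratedDeriv_const_add (by omega)]
    rfl
  rw [h1, iteratedDeriv_mul hf.contDiffAt hha.contDiffAt, Finset.sum_range_succ', iteratedDeriv_zero,
    h0, mul_zero, zero_mul, add_zero, Finset.sum_div]
  refine Finset.sum_congr rfl fun k hk => ?_
  have hk' : k + 1 ≤ m + 1 := Finset.mem_range.1 hk
  rw [Nat.cast_choose ℂ hk', Nat.add_sub_add_right]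
  have f1 : ((m + 1).factorial : ℂ) ≠ 0 := Nat.cast_ne_zero.2 (Nat.factorial_ne_zero _)
  have f2 : ((k + 1).factorial : ℂ) ≠ 0 := Nat.cast_ne_zero.2 (Nat.factorial_ne_zero _)
  have f3 : ((m - k).factorial : ℂ) ≠ 0 := Nat.cast_ne_zero.2 (Nat.factorial_ne_zero _)
  field_simp

theorem ne_one_of_geomCoeff {f : ℂ → ℂ} (hf : Differentiable ℂ f) (h0 : f 0 = 0)
    (hp : ∀ q : ℝ, 0 < q → ∃ C, ∀ n, ‖geomCoeff (fun k =>
      iteratedDeriv (k + 1) f 0 / (k + 1).factorial) n‖ ≤ C * q ^ n) (z : ℂ) : f z ≠ 1 := by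
  set c : ℕ → ℂ := fun k => iteratedDeriv k f 0 / k.factorial with hc
  set p : ℕ → ℂ := geomCoeff (fun k => c (k + 1)) with hpdef
  have hc0 : c 0 = 0 := by simp [hc, h0]
  have hfs : HasSum (fun n => c n * z ^ n) (f z) := by
    have := Complex.hasSum_taylorSeries_of_entire hf 0 z
    simp only [sub_zero, smul_eq_mul] at this
    have h1 : ∀ n, c n * z ^ n = (n.factorial : ℂ)⁻¹ * (z ^ n * iteratedDeriv n f 0) := fun n => by
      simp only [hc]
      ring
    exact (funext h1 : (fun n => c n * z ^ n) = _) ▸ this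
  have hps : Summable fun n => ‖p n * z ^ n‖ := by
    obtain ⟨C, hC⟩ := hp (1 / (2 * (‖z‖ + 1))) (by positivity)
    refine Summable.of_nonneg_of_le (fun _ => norm_nonneg _) (fun n => ?_)
      ((summable_geometric_of_lt_one (by norm_num : (0 : ℝ) ≤ 1 / 2) (by norm_num)).mul_left C)
    have hC0 : 0 ≤ C := by simpa using (norm_nonneg _).trans (hC 0)
    rw [norm_mul, norm_pow]
    calc ‖p n‖ * ‖z‖ ^ n ≤ (C * (1 / (2 * (‖z‖ + 1))) ^ n) * (‖z‖ + 1) ^ n := by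
          gcongr
          · exact hC n
          · linarith
      _ = C * (1 / 2) ^ n := by
          rw [mul_assoc, ← mul_pow]
          congr 2
          field_simp
  have hprod := tsum_mul_tsum_eq_tsum_sum_range_of_summable_norm hfs.summable.norm hps
  intro hz
  rw [hfs.tsum_eq, hz, one_mul] at hprod
  have hterm : ∀ n, ∑ k ∈ Finset.range (n + 1), c k * z ^ k * (p (n - k) * z ^ (n - k)) =
      p n * z ^ n - if n = 0 then 1 else 0 := by
    intro n
    have : ∀ k ∈ Finset.range (n + 1), c k * z ^ k * (p (n - k) * z ^ (n - k)) =
        (c k * p (n - k)) * z ^ n := by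
      intro k hk
      rw [← Nat.add_sub_of_le (Nat.lt_succ_iff.1 (Finset.mem_range.1 hk)), pow_add]
      simp only [Nat.add_sub_cancel_left]
      ring
    rw [Finset.sum_congr rfl this, ← Finset.sum_mul]
    cases n with
    | zero => simp [hc0, hpdef, geomCoeff_zero]
    | succ n =>
      rw [Finset.sum_range_succ', hc0, zero_mul, add_zero, if_neg (by omega), sub_zero, hpdef,
        geomCoeff_succ]
      congr 1
      exact Finset.sum_congr rfl fun k _ => by rw [Nat.add_sub_add_right]
  rw [tsum_congr hterm, hps.of_norm.tsum_sub (hasSum_ite_eq 0 1).summable, tsum_ite_eq] at hprod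
  exact one_ne_zero (sub_eq_self.1 hprod.symm)

theorem countable_setOf_forall_mul_ne_one {f : ℂ → ℂ} (hf : Differentiable ℂ f) {z₁ z₂ : ℂ}
    (hne : f z₁ ≠ f z₂) : {x : ℂ | ∀ z, x * f z ≠ 1}.Countable := by
  have hsub : ({x : ℂ | ∀ z, x * f z ≠ 1} \ {0}).Subsingleton := by
    rintro x ⟨hx, hx0⟩ y ⟨hy, hy0⟩
    by_contra hxy
    refine hne (little_picard hf (a := x⁻¹) (b := y⁻¹) (fun h => hxy (inv_injective h))
      (fun z hz => hx z ?_) (fun z hz => hy z ?_) z₁ z₂)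
    · rw [hz, mul_inv_cancel₀ hx0]
    · rw [hz, mul_inv_cancel₀ hy0]
  refine (hsub.countable.insert 0).mono fun x hx => ?_
  by_cases h : x = 0
  · exact Or.inl h
  · exact Or.inr ⟨hx, h⟩

theorem exists_tinyFamily {F : ℂ × ℂ → ℂ} {U : Set ℂ} (hU : IsOpen U)
    (hsub : Metric.closedBall 0 1 ⊆ U) (hF : AnalyticOnNhd ℂ F (Set.univ ×ˢ U))
    (hF0 : ∀ w ∈ U, F (0, w) = 0) {z₁ z₂ : ℂ} (hnc : F (z₁, 0) ≠ F (z₂, 0)) {g : ℂ → ℂ}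
    (hg : ContinuousOn g (Metric.closedBall 0 1))
    (hne : ∀ w ∈ Metric.closedBall (0 : ℂ) 1, ∀ z, g w * F (z, w) ≠ 1) :
    ∃ P, TinyFamily P g := by
  have hcb := isCompact_closedBall (0 : ℂ) 1
  set e : ℕ → Polynomial discAnalytic := fun k => Polynomial.C
    ⟨fiberCoeff F (k + 1), (analyticOnNhd_fiberCoeff hU hF (k + 1)).mono hsub⟩ * Polynomial.X with he
  set P : ℕ → Polynomial discAnalytic := geomCoeff e
  have hPe : ∀ n w b, polyEval (P n) w b = geomCoeff (fun k => fiberCoeff F (k + 1) w * b) n := by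
    intro n w b
    refine (map_geomCoeff (R := Polynomial discAnalytic) (R' := ℂ)
      (Polynomial.eval₂RingHom (discEval w) b) e n).trans ?_
    congr 1
    funext k
    simp [he]
  have hPd : ∀ n w b, polyEval (P n) w b = geomCoeff (fun k =>
      iteratedDeriv (k + 1) (fun z => b * F (z, w)) 0 / (k + 1).factorial) n := by
    intro n w b
    rw [hPe]
    congr 1
    funext k
    rw [iteratedDeriv_const_mul_field, fiberCoeff]
    ring
  have hFd : ∀ w ∈ Metric.closedBall (0 : ℂ) 1, Differentiable ℂ fun z => F (z, w) := fun w hw =>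
    differentiable_fiber hF (hsub hw)
  have hFc : ∀ r : ℝ, ContinuousOn F (Metric.closedBall 0 r ×ˢ Metric.closedBall 0 1) := fun r =>
    hF.continuousOn.mono (Set.prod_mono (Set.subset_univ _) hsub)
  refine ⟨P, hg, fun L => ?_, fun q hq => ?_, ?_⟩
  · obtain ⟨M, hM⟩ := ((isCompact_closedBall (0 : ℂ) 1).prod hcb).exists_bound_of_continuousOn (hFc 1)
    have hM0 : 0 ≤ M := (norm_nonneg _).trans (hM (0, 0) (by simp))
    refine ⟨M * |L| + 1, by positivity, fun n w hw b hb => ?_⟩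
    rw [hPe]
    refine norm_geomCoeff_le (fun k => ?_) n
    rw [norm_mul]
    gcongr
    · have := norm_iteratedDeriv_div_factorial_le (h := fun z => F (z, w)) (M := M) one_pos
        (hFd w hw).differentiableOn
        (fun z hz => hM (z, w) ⟨Metric.sphere_subset_closedBall hz, hw⟩) (k + 1)
      simpa [fiberCoeff] using this
    · exact hb.trans (le_abs_self _)
  · set r : ℝ := q⁻¹ with hr
    have hr0 : 0 < r := by positivity
    have hK := (isCompact_closedBall (0 : ℂ) r).prod hcb
    obtain ⟨M, hM⟩ := hK.exists_bound_of_continuousOn (hFc r)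
    have hM0 : 0 ≤ M := (norm_nonneg _).trans (hM (0, 0) (by simp [hr0.le]))
    have hcont : ContinuousOn (fun p : ℂ × ℂ => ‖1 - g p.2 * F p‖)
        (Metric.closedBall 0 r ×ˢ Metric.closedBall 0 1) := by
      have h1 : ContinuousOn (fun p : ℂ × ℂ => g p.2)
          (Metric.closedBall 0 r ×ˢ Metric.closedBall 0 1) :=
        hg.comp continuousOn_snd fun p hp => hp.2
      exact (continuousOn_const.sub (h1.mul (hFc r))).norm
    obtain ⟨p₀, hp₀, hmin⟩ := hK.exists_isMinOn ⟨(0, 0), by simp [hr0.le]⟩ hcont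
    set m : ℝ := ‖1 - g p₀.2 * F p₀‖ with hm
    have hm0 : 0 < m := norm_pos_iff.2 (sub_ne_zero.2 (hne p₀.2 hp₀.2 p₀.1).symm)
    refine ⟨m / (2 * (M + 1)), by positivity, 2 / m, by positivity, fun n w hw b hb => ?_⟩
    have hlow : ∀ z ∈ Metric.closedBall (0 : ℂ) r, m / 2 ≤ ‖1 - b * F (z, w)‖ := by
      intro z hz
      have h1 : m ≤ ‖1 - g w * F (z, w)‖ := hmin (show (z, w) ∈ _ from ⟨hz, hw⟩)
      have h2 : ‖(b - g w) * F (z, w)‖ ≤ m / 2 := by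
        rw [norm_mul]
        calc ‖b - g w‖ * ‖F (z, w)‖ ≤ m / (2 * (M + 1)) * (M + 1) := by
              gcongr
              exact (hM (z, w) ⟨hz, hw⟩).trans (by linarith)
          _ = m / 2 := by field_simp
      have h3 := norm_sub_norm_le (1 - g w * F (z, w)) ((b - g w) * F (z, w))
      have h4 : 1 - g w * F (z, w) - (b - g w) * F (z, w) = 1 - b * F (z, w) := by ring
      rw [h4] at h3
      linarith
    have hbd : Differentiable ℂ fun z => b * F (z, w) := (hFd w hw).const_mul b
    rw [hPd, ← iteratedDeriv_one_div_one_sub (hbd.analyticAt 0)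
      (by simp only [hF0 w (hsub hw), mul_zero])]
    have := norm_iteratedDeriv_div_factorial_le (h := fun z => (1 - b * F (z, w))⁻¹) (M := 2 / m) hr0
      (fun z hz => ((differentiableAt_const _).sub (hbd z)).inv (by
        intro h
        have := hlow z hz
        simp only [Pi.sub_apply] at h
        rw [h, norm_zero] at this
        linarith) |>.differentiableWithinAt)
      (fun z hz => by
        rw [norm_inv, ← inv_div]
        exact inv_anti₀ (by positivity) (hlow z (Metric.sphere_subset_closedBall hz))) n
    refine this.trans_eq ?_
    rw [hr, inv_pow, div_inv_eq_mul]
  · refine (countable_setOf_forall_mul_ne_one (hFd 0 (by simp)) hnc).mono fun x hx => ?_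
    refine ne_one_of_geomCoeff ((hFd 0 (by simp)).const_mul x)
      (by simp only [hF0 0 (hsub (by simp)), mul_zero]) fun q hq => ?_
    obtain ⟨C, hC⟩ := hx q hq
    exact ⟨C, fun n => by rw [← hPd]; exact hC n⟩

theorem circleAverage_eq_circleAverage_zero_one (h : ℂ → ℂ) (c : ℂ) (R : ℝ) :
    Real.circleAverage h c R = Real.circleAverage (fun w => h (c + R * w)) 0 1 := by
  simp only [Real.circleAverage_def, circleMap, zero_add, Complex.ofReal_one, one_mul]

theorem differentiableOn_of_mul_ne_one_of_zero {F : ℂ × ℂ → ℂ} {U : Set ℂ} (hU : IsOpen U)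
    (hF : AnalyticOnNhd ℂ F (Set.univ ×ˢ U)) (hF0 : ∀ w ∈ U, F (0, w) = 0)
    (hnc : ∀ w ∈ U, ∃ z₁ z₂, F (z₁, w) ≠ F (z₂, w)) {g : ℂ → ℂ} (hg : ContinuousOn g U)
    (hne : ∀ w ∈ U, ∀ z, g w * F (z, w) ≠ 1) : DifferentiableOn ℂ g U := by
  intro x hx
  obtain ⟨ρ, hρ, hball⟩ := Metric.isOpen_iff.1 hU x hx
  set r : ℝ := ρ / 4 with hr
  have hr0 : 0 < r := by positivity
  have hKU : Metric.closedBall x (2 * r) ⊆ U :=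
    (Metric.closedBall_subset_ball (by linarith)).trans hball
  obtain ⟨G, hG⟩ := ContinuousMap.exists_restrict_eq (Y := ℂ) (Metric.isClosed_closedBall (x := x)
    (ε := 2 * r)) ⟨(Metric.closedBall x (2 * r)).domRestrict g, (hg.mono hKU).domRestrict⟩
  have hGg : ∀ w ∈ Metric.closedBall x (2 * r), G w = g w := fun w hw =>
    congrArg (fun k : C(Metric.closedBall x (2 * r), ℂ) => k ⟨w, hw⟩) hG
  have hd := differentiableOn_ball_of_circleAverage_eq_zero G.continuous hr0 (x := x) (by
    intro c R hR hcR
    have hcR' : ∀ w ∈ Metric.closedBall (0 : ℂ) 1, c + R * w ∈ Metric.closedBall x (2 * r) := by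
      intro w hw
      refine Metric.ball_subset_closedBall (hcR ?_)
      rw [Metric.mem_closedBall, dist_eq_norm, add_sub_cancel_left, norm_mul, Complex.norm_real,
        Real.norm_of_nonneg hR.le]
      exact mul_le_of_le_one_right hR.le (by simpa using hw)
    set A : ℂ → ℂ := fun w => c + R * w with hA
    have hAd : Differentiable ℂ A := by fun_prop
    obtain ⟨z₁, z₂, hz⟩ := hnc c (hKU (by simpa using hcR' 0 (by simp)))
    obtain ⟨P, hP⟩ := exists_tinyFamily (F := fun p => F (p.1, A p.2)) (U := A ⁻¹' U) (g := g ∘ A)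
      (hU.preimage hAd.continuous) (fun w hw => hKU (hcR' w hw))
      (fun p hp => (hF (p.1, A p.2) ⟨trivial, hp.2⟩).comp
        (f := fun p : ℂ × ℂ => (p.1, A p.2))
        (analyticAt_fst.prod ((hAd.analyticAt _).comp analyticAt_snd)))
      (fun w hw => hF0 _ hw) (z₁ := z₁) (z₂ := z₂) (by simpa [hA] using hz)
      (hg.comp hAd.continuous.continuousOn fun w hw => hKU (hcR' w hw))
      (fun w hw z => hne _ (hKU (hcR' w hw)) z)
    rw [circleAverage_eq_circleAverage_zero_one]
    have h1 : Real.circleAverage (fun w => (c + R * w - c) * G (c + R * w)) 0 1 =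
        Real.circleAverage (fun w => (R : ℂ) • (w * (g ∘ A) w)) 0 1 := by
      refine Real.circleAverage_congr_sphere fun w hw => ?_
      rw [abs_one] at hw
      simp only [add_sub_cancel_left, smul_eq_mul]
      rw [hGg _ (hcR' w (Metric.sphere_subset_closedBall hw)), mul_assoc]
      rfl
    rw [h1, Real.circleAverage_fun_smul, hP.circleAverage_mul_eq_zero, smul_zero])
  have hxG : DifferentiableAt ℂ G x := hd.differentiableAt (Metric.ball_mem_nhds x hr0)
  refine (hxG.congr_of_eventuallyEq ?_).differentiableWithinAt
  filter_upwards [Metric.closedBall_mem_nhds x (by positivity : 0 < 2 * r)] with w hw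
  exact (hGg w hw).symm

/-- A continuous function `g` with `g w * f (z, w) ≠ 1` is holomorphic. -/
theorem differentiableOn_of_mul_ne_one {f : ℂ × ℂ → ℂ} {U : Set ℂ} (hU : IsOpen U)
    (hf : AnalyticOnNhd ℂ f (Set.univ ×ˢ U))
    (hnc : ∀ w ∈ U, ∃ z₁ z₂, f (z₁, w) ≠ f (z₂, w)) {g : ℂ → ℂ} (hg : ContinuousOn g U)
    (hne : ∀ w ∈ U, ∀ z, g w * f (z, w) ≠ 1) : DifferentiableOn ℂ g U := by
  have hf0 : AnalyticOnNhd ℂ (fun w => f (0, w)) U := fun w hw =>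
    (hf (0, w) ⟨trivial, hw⟩).comp (f := fun w => (0, w))
      (AnalyticAt.prod analyticAt_const analyticAt_id)
  have h1 : ∀ w ∈ U, 1 - g w * f (0, w) ≠ 0 := fun w hw => sub_ne_zero.2 (hne w hw 0).symm
  set k : ℂ → ℂ := fun w => g w / (1 - g w * f (0, w)) with hk
  have hkd : DifferentiableOn ℂ k U := by
    refine differentiableOn_of_mul_ne_one_of_zero (F := fun p => f p - f (0, p.2)) hU ?_ ?_ ?_ ?_ ?_
    · exact fun p hp => (hf p hp).sub ((hf0 p.2 hp.2).comp analyticAt_snd)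
    · exact fun w _ => sub_self _
    · intro w hw
      obtain ⟨z₁, z₂, h⟩ := hnc w hw
      exact ⟨z₁, z₂, fun h' => h (sub_left_injective h')⟩
    · exact hg.div (continuousOn_const.sub (hg.mul hf0.continuousOn)) h1
    · intro w hw z h
      refine hne w hw z ?_
      have := h1 w hw
      simp only [hk] at h
      field_simp at h
      linear_combination h
  have h2 : ∀ w ∈ U, 1 + k w * f (0, w) = (1 - g w * f (0, w))⁻¹ := fun w hw => by
    have := h1 w hw
    simp only [hk]
    field_simp
    ring
  have h3 : DifferentiableOn ℂ (fun w => k w / (1 + k w * f (0, w))) U := by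
    refine hkd.div ((differentiableOn_const _).add (hkd.mul hf0.differentiableOn)) fun w hw => ?_
    have := inv_ne_zero (h1 w hw)
    rwa [← h2 w hw] at this
  refine h3.congr fun w hw => ?_
  have := h1 w hw
  rw [h2 w hw]
  simp only [hk]
  field_simp

/-- `a w` is an omitted value of the nonconstant entire function `z ↦ f (z, w)`, for `w ∈ D`. -/
structure IsOmittedSelection (f : ℂ × ℂ → ℂ) (D : Set ℂ) (a : ℂ → ℂ) : Prop where
  isOpen : IsOpen D
  analytic : AnalyticOnNhd ℂ f (Set.univ ×ˢ D)
  nonconst : ∀ w ∈ D, ∃ z₁ z₂ : ℂ, f (z₁, w) ≠ f (z₂, w)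
  omitted : ∀ w ∈ D, ∀ z : ℂ, f (z, w) ≠ a w

namespace IsOmittedSelection

variable {f : ℂ × ℂ → ℂ} {D : Set ℂ} {a : ℂ → ℂ}

/-- The graph of a selection of omitted values is closed. -/
theorem eq_of_mapClusterPt (h : IsOmittedSelection f D a) {w₀ b : ℂ} (hw₀ : w₀ ∈ D)
    (hb : MapClusterPt b (nhds w₀) a) : b = a w₀ := by
  have hd : ∀ w ∈ D, Differentiable ℂ fun z => f (z, w) := fun w hw =>
    differentiable_fiber h.analytic hw
  obtain ⟨z₁, z₂, hz⟩ := h.nonconst w₀ hw₀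
  by_contra hne
  refine hz (little_picard (hd w₀ hw₀) hne (fun z₀ hz₀ => ?_) (h.omitted w₀ hw₀) z₁ z₂)
  have han : AnalyticOnNhd ℂ (fun z => f (z, w₀) - b) Set.univ := fun z _ =>
    ((hd w₀ hw₀).sub_const b).analyticAt z
  have hiso : ∀ᶠ z in nhdsWithin z₀ {z₀}ᶜ, f (z, w₀) - b ≠ 0 := by
    refine (han z₀ trivial).eventually_eq_zero_or_eventually_ne_zero.resolve_left fun h0 => hz ?_
    have := han.eqOn_zero_of_preconnected_of_eventuallyEq_zero isPreconnected_univ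
      (Set.mem_univ z₀) h0
    rw [sub_eq_zero.1 (this (Set.mem_univ z₁)), sub_eq_zero.1 (this (Set.mem_univ z₂))]
  obtain ⟨ρ, hρ, hball⟩ := Metric.mem_nhdsWithin_iff.1 hiso
  set r : ℝ := ρ / 2 with hr
  have hr0 : 0 < r := by positivity
  have hcont : Continuous fun z => ‖f (z, w₀) - b‖ := 
    ((hd w₀ hw₀).continuous.sub continuous_const).norm
  obtain ⟨ζ, hζ, hmin⟩ := (isCompact_sphere z₀ r).exists_isMinOn
    (NormedSpace.sphere_nonempty.2 hr0.le) hcont.continuousOn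
  set m : ℝ := ‖f (ζ, w₀) - b‖ with hm
  have hm0 : 0 < m := by
    refine norm_pos_iff.2 (hball ⟨?_, ?_⟩)
    · rw [Metric.mem_ball, Metric.mem_sphere.1 hζ]; linarith
    · exact ne_of_mem_of_not_mem hζ (by simp [hr0.ne])
  have hfc : ∀ z, ContinuousAt (fun p : ℂ × ℂ => ‖f (p.2, p.1) - b‖) (w₀, z) := by
    intro z
    have h1 : ContinuousAt f (z, w₀) := (h.analytic (z, w₀) ⟨trivial, hw₀⟩).continuousAt
    exact ((h1.comp (f := fun p : ℂ × ℂ => (p.2, p.1)) (x := (w₀, z))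
      continuous_swap.continuousAt).sub continuousAt_const).norm
  have ev1 : ∀ᶠ w in nhds w₀, ∀ z ∈ Metric.sphere z₀ r, 3 * m / 4 < ‖f (z, w) - b‖ := by
    refine (isCompact_sphere z₀ r).eventually_forall_of_forall_eventually fun z hz => ?_
    refine (hfc z).eventually (lt_mem_nhds ?_)
    have : m ≤ ‖f (z, w₀) - b‖ := hmin hz
    simp only
    linarith
  have ev2 : ∀ᶠ w in nhds w₀, ‖f (z₀, w) - b‖ < m / 4 := by
    have h1 : ContinuousAt (fun w => ‖f (z₀, w) - b‖) w₀ :=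
      (hfc z₀).comp (f := fun w => (w, z₀)) (by fun_prop)
    refine h1.eventually (gt_mem_nhds ?_)
    change ‖f (z₀, w₀) - b‖ < m / 4
    rw [hz₀, sub_self, norm_zero]
    positivity
  have fr : ∃ᶠ w in nhds w₀, a w ∈ Metric.ball b (m / 4) :=
    hb.frequently (Metric.ball_mem_nhds b (by positivity))
  obtain ⟨w, hwa, hw1, hw2, hwD⟩ :=
    (fr.and_eventually (ev1.and (ev2.and (h.isOpen.mem_nhds hw₀)))).exists
  rw [Metric.mem_ball, dist_eq_norm] at hwa
  have hnz : ∀ z, f (z, w) - a w ≠ 0 := fun z => sub_ne_zero.2 (h.omitted w hwD z)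
  have hk : Differentiable ℂ fun z => (f (z, w) - a w)⁻¹ := fun z =>
    ((hd w hwD z).sub_const _).inv (hnz z)
  have hmax := Complex.norm_le_of_forall_mem_frontier_norm_le (U := Metric.ball z₀ r) (z := z₀)
    (C := (m / 2)⁻¹) Metric.isBounded_ball hk.diffContOnCl (fun z hz => by
      rw [frontier_ball z₀ hr0.ne'] at hz
      rw [norm_inv]
      refine inv_anti₀ (by positivity) ?_
      have h1 := hw1 z hz
      have h2 := norm_sub_norm_le (f (z, w) - b) (a w - b)
      rw [sub_sub_sub_cancel_right] at h2
      linarith) (subset_closure (Metric.mem_ball_self hr0))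
  rw [norm_inv, inv_le_inv₀ (norm_pos_iff.2 (hnz z₀)) (by positivity)] at hmax
  have h3 := norm_sub_le (f (z₀, w) - b) (a w - b)
  rw [sub_sub_sub_cancel_right] at h3
  linarith

theorem mem_of_mem_closure (h : IsOmittedSelection f D a) {w₀ : ℂ} (hw₀ : w₀ ∈ D) {A K : Set ℂ}
    (hA : w₀ ∈ closure A) (hK : IsCompact K) (hAK : ∀ w ∈ A, a w ∈ K) : a w₀ ∈ K := by
  have : (nhdsWithin w₀ A).NeBot := mem_closure_iff_nhdsWithin_neBot.1 hA
  obtain ⟨b, hbK, hb⟩ := hK.exists_mapClusterPt (f := nhdsWithin w₀ A) (u := a)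
    (by rw [le_principal_iff]; exact mem_map.2 (mem_of_superset self_mem_nhdsWithin hAK))
  rwa [← h.eq_of_mapClusterPt hw₀ (hb.mono (map_mono nhdsWithin_le_nhds))]

/-- The points near which the selection is bounded. -/
def boundedSet (D : Set ℂ) (a : ℂ → ℂ) : Set ℂ :=
  {w | w ∈ D ∧ ∃ M : ℝ, ∀ᶠ w' in nhds w, ‖a w'‖ ≤ M}

theorem isOpen_boundedSet (h : IsOmittedSelection f D a) : IsOpen (boundedSet D a) := by
  rw [isOpen_iff_mem_nhds]
  rintro w ⟨hw, M, hM⟩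
  filter_upwards [h.isOpen.mem_nhds hw, hM.eventually_nhds] with w' h1 h2
  exact ⟨h1, M, h2⟩

theorem continuousAt (h : IsOmittedSelection f D a) {w : ℂ} (hw : w ∈ boundedSet D a) :
    ContinuousAt a w := by
  obtain ⟨hwD, M, hM⟩ := hw
  refine (isCompact_closedBall (0 : ℂ) M).tendsto_nhds_of_unique_mapClusterPt
    (hM.mono fun w' h' => by simpa using h') fun b _ hb => h.eq_of_mapClusterPt hwD hb

theorem analyticAt (h : IsOmittedSelection f D a) {w : ℂ} (hw : w ∈ boundedSet D a) :
    AnalyticAt ℂ a w := by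
  have hac : ContinuousOn a (boundedSet D a) := fun w hw => (h.continuousAt hw).continuousWithinAt
  set m : ℂ := a w + 1 with hm
  set U : Set ℂ := boundedSet D a ∩ a ⁻¹' {m}ᶜ with hU
  have hUo : IsOpen U := hac.isOpen_inter_preimage h.isOpen_boundedSet isOpen_compl_singleton
  have hUD : U ⊆ D := fun w hw => hw.1.1
  have hne : ∀ w ∈ U, a w - m ≠ 0 := fun w hw => sub_ne_zero.2 hw.2
  have hg : DifferentiableOn ℂ (fun w => (a w - m)⁻¹) U := by
    refine differentiableOn_of_mul_ne_one (f := fun p => f p - m) hUo ?_ ?_ ?_ ?_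
    · exact fun p hp => (h.analytic p ⟨trivial, hUD hp.2⟩).sub analyticAt_const
    · intro w hw
      obtain ⟨z₁, z₂, hz⟩ := h.nonconst w (hUD hw)
      exact ⟨z₁, z₂, fun h' => hz (sub_left_injective h')⟩
    · exact ((hac.mono Set.inter_subset_left).sub continuousOn_const).inv₀ hne
    · intro w hw z hz
      rw [inv_mul_eq_one₀ (hne w hw)] at hz
      exact h.omitted w (hUD hw) z (sub_left_injective hz).symm
  have had : DifferentiableOn ℂ a U := by
    refine ((hg.inv fun w hw => inv_ne_zero (hne w hw)).add_const m).congr fun w hw => ?_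
    simp
  exact had.analyticAt (hUo.mem_nhds ⟨hw, by simp [hm]⟩)

/-- Isolated points of the complement of the bounded set at which the selection tends to
infinity. -/
def poleSet (D : Set ℂ) (a : ℂ → ℂ) : Set ℂ :=
  {w | w ∈ D ∧ (∀ᶠ w' in nhdsWithin w {w}ᶜ, w' ∈ boundedSet D a) ∧
    Tendsto (fun w' => ‖a w'‖) (nhdsWithin w {w}ᶜ) atTop}

theorem isOpen_boundedSet_union_poleSet (h : IsOmittedSelection f D a) :
    IsOpen (boundedSet D a ∪ poleSet D a) := by
  rw [isOpen_iff_mem_nhds]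
  rintro w (hw | hw)
  · exact mem_of_superset (h.isOpen_boundedSet.mem_nhds hw) Set.subset_union_left
  · filter_upwards [eventually_nhdsWithin_iff.1 hw.2.1] with w' hw'
    rcases eq_or_ne w' w with rfl | hne
    · exact Or.inr hw
    · exact Or.inl (hw' hne)

/-- A compact set of values missed at a point is missed at all nearby points. -/
theorem eventually_notMem (h : IsOmittedSelection f D a) {w₀ : ℂ} (hw₀ : w₀ ∈ D) {K : Set ℂ}
    (hK : IsCompact K) (hw : a w₀ ∉ K) : ∀ᶠ w in nhds w₀, a w ∉ K := by
  by_contra hcon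
  exact hw (h.mem_of_mem_closure hw₀ (A := a ⁻¹' K) (mem_closure_iff_frequently.2
    (not_eventually.1 hcon |>.mono fun w hw => not_not.1 hw)) hK fun w hw => hw)

theorem isCompact_annulus (s t : ℝ) : IsCompact {z : ℂ | s ≤ ‖z‖ ∧ ‖z‖ ≤ t} := by
  refine (isCompact_closedBall (0 : ℂ) t).of_isClosed_subset
    ((isClosed_le continuous_const continuous_norm).inter
      (isClosed_le continuous_norm continuous_const)) fun z hz => by simpa using hz.2

open Classical in
/-- The inverse of the large branch of a selection, extended by zero. -/
noncomputable def largeInv (D : Set ℂ) (a : ℂ → ℂ) (n : ℝ) (w : ℂ) : ℂ :=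
  if n + 2 < ‖a w‖ ∧ w ∉ poleSet D a then (a w)⁻¹ else 0

theorem norm_largeInv_le (D : Set ℂ) (a : ℂ → ℂ) (n : ℝ) (w : ℂ) :
    ‖largeInv D a n w‖ ≤ ‖a w‖⁻¹ := by
  unfold largeInv
  split_ifs <;> simp

theorem continuousAt_largeInv (h : IsOmittedSelection f D a) {n : ℝ} {B : Set ℂ}
    (hB : IsOpen B) (hBD : B ⊆ D) (hn : 0 ≤ n)
    (hbig : ∀ w ∈ B, w ∉ boundedSet D a → w ∉ poleSet D a → ‖a w‖ ≤ n)
    (hgap : ∀ w ∈ B, ‖a w‖ < n + 1 ∨ n + 2 < ‖a w‖) {w₀ : ℂ} (hw₀ : w₀ ∈ B) :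
    ContinuousAt (largeInv D a n) w₀ := by
  have hBn := hB.mem_nhds hw₀
  by_cases hp : w₀ ∈ poleSet D a
  · have h0 : largeInv D a n w₀ = 0 := if_neg fun h' => h'.2 hp
    rw [continuousAt_iff_punctured_nhds, h0]
    exact squeeze_zero_norm (norm_largeInv_le D a n) hp.2.2.inv_tendsto_atTop
  rcases hgap w₀ hw₀ with hs | hl
  · have h0 : largeInv D a n w₀ = 0 := if_neg fun h' => by linarith [h'.1]
    rw [ContinuousAt, h0, Metric.tendsto_nhds]
    intro ε hε
    filter_upwards [hBn, h.eventually_notMem (hBD hw₀) (isCompact_annulus (n + 1) (ε⁻¹))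
      fun h' => by linarith [h'.1]] with w hwB hwK
    rw [dist_zero_right]
    by_cases hc : n + 2 < ‖a w‖ ∧ w ∉ poleSet D a
    · refine (norm_largeInv_le D a n w).trans_lt (inv_lt_of_inv_lt₀ hε ?_)
      by_contra! hcon
      exact hwK ⟨by linarith [hc.1], hcon⟩
    · rw [largeInv, if_neg hc, norm_zero]
      exact hε
  · have hC : w₀ ∈ boundedSet D a := by
      by_contra hC
      linarith [hbig w₀ hw₀ hC hp]
    have hac := h.continuousAt hC
    have hne : a w₀ ≠ 0 := norm_pos_iff.1 (by linarith)
    refine (hac.inv₀ hne).congr ?_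
    filter_upwards [h.isOpen_boundedSet.mem_nhds hC, hac.norm.eventually (lt_mem_nhds hl)]
      with w hwC hwl
    refine (if_pos ⟨hwl, fun hp' => ?_⟩).symm
    obtain ⟨-, M, hM⟩ := hwC
    obtain ⟨w', h1, h2⟩ := ((hM.filter_mono nhdsWithin_le_nhds).and
      (hp'.2.2.eventually_gt_atTop M)).exists
    linarith

/-- A selection that is bounded off its poles and its analytic locus has only such points. -/
theorem mem_union_of_gap (h : IsOmittedSelection f D a) {n : ℝ} {B : Set ℂ}
    (hB : IsOpen B) (hBD : B ⊆ D) (hn : 0 ≤ n)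
    (hbig : ∀ w ∈ B, w ∉ boundedSet D a → w ∉ poleSet D a → ‖a w‖ ≤ n)
    (hgap : ∀ w ∈ B, ‖a w‖ < n + 1 ∨ n + 2 < ‖a w‖) {e : ℂ} (he : e ∈ B) :
    e ∈ boundedSet D a ∪ poleSet D a := by
  by_contra hcon
  obtain ⟨heC, heP⟩ := not_or.1 hcon
  have hcont : ContinuousOn (largeInv D a n) B := fun w hw =>
    (h.continuousAt_largeInv hB hBD hn hbig hgap hw).continuousWithinAt
  have hdiff : DifferentiableOn ℂ (largeInv D a n) B := by
    refine differentiableOn_of_mul_ne_one (f := f) hB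
      (h.analytic.mono (Set.prod_mono le_rfl hBD)) (fun w hw => h.nonconst w (hBD hw)) hcont ?_
    intro w hw z hz
    by_cases hc : n + 2 < ‖a w‖ ∧ w ∉ poleSet D a
    · rw [largeInv, if_pos hc, inv_mul_eq_one₀ (norm_pos_iff.1 (by linarith [hc.1]))] at hz
      exact h.omitted w (hBD hw) z hz.symm
    · rw [largeInv, if_neg hc, zero_mul] at hz
      exact zero_ne_one hz
  have hlarge : ∀ w ∈ B, largeInv D a n w ≠ 0 → n + 2 < ‖a w‖ ∧ w ∉ poleSet D a :=
    fun w _ h0 => by_contra fun hc => h0 (if_neg hc)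
  have heq : largeInv D a n e = 0 := if_neg fun h' => by linarith [hbig e he heC heP, h'.1]
  rcases (hdiff.analyticAt (hB.mem_nhds he)).eventually_eq_zero_or_eventually_ne_zero with h0 | h0
  · refine heC ⟨hBD he, n + 1, ?_⟩
    filter_upwards [h0.eventually_nhds, hB.mem_nhds he] with w hw hwB
    refine (hgap w hwB).elim le_of_lt fun hl => ?_
    by_cases hp : w ∈ poleSet D a
    · exfalso
      obtain ⟨w', hw'0, hw'C, hw'l⟩ := ((hw.filter_mono nhdsWithin_le_nhds).and
        (hp.2.1.and (hp.2.2.eventually_gt_atTop (n + 2)))).exists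
      have hp' : w' ∉ poleSet D a := by
        rintro ⟨-, -, ht⟩
        obtain ⟨-, M, hM⟩ := hw'C
        obtain ⟨w'', h1, h2⟩ := ((hM.filter_mono nhdsWithin_le_nhds).and
          (ht.eventually_gt_atTop M)).exists
        linarith
      rw [largeInv, if_pos ⟨hw'l, hp'⟩, inv_eq_zero] at hw'0
      rw [hw'0, norm_zero] at hw'l
      linarith
    · have := hw.self_of_nhds
      rw [largeInv, if_pos ⟨hl, hp⟩, inv_eq_zero] at this
      rw [this, norm_zero] at hl
      linarith
  · have hB' : ∀ᶠ w in nhdsWithin e {e}ᶜ, w ∈ B := nhdsWithin_le_nhds (hB.mem_nhds he)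
    refine heP ⟨hBD he, ?_, ?_⟩
    · filter_upwards [h0, hB'] with w hw hwB
      obtain ⟨h1, h2⟩ := hlarge w hwB hw
      by_contra hC
      linarith [hbig w hwB hC h2]
    · have ht : Tendsto (largeInv D a n) (nhdsWithin e {e}ᶜ) (nhdsWithin 0 {0}ᶜ) := by
        refine tendsto_nhdsWithin_iff.2 ⟨?_, h0⟩
        have := (hcont.continuousAt (hB.mem_nhds he)).tendsto
        rw [heq] at this
        exact this.mono_left nhdsWithin_le_nhds
      refine (tendsto_norm_inv_nhdsNE_zero_atTop.comp ht).congr' ?_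
      filter_upwards [h0, hB'] with w hw hwB
      simp only [Function.comp_apply]
      rw [largeInv, if_pos (hlarge w hwB hw), inv_inv]

theorem mem_boundedSet_union_poleSet (h : IsOmittedSelection f D a) {w : ℂ} (hw : w ∈ D) :
    w ∈ boundedSet D a ∪ poleSet D a := by
  by_contra hcon
  set S : Set ℂ := D \ (boundedSet D a ∪ poleSet D a) with hS
  have hloc : IsLocallyClosed S :=
    h.isOpen.isLocallyClosed.inter h.isOpen_boundedSet_union_poleSet.isClosed_compl.isLocallyClosed
  have : LocallyCompactSpace S := hloc.locallyCompactSpace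
  have : Nonempty S := ⟨⟨w, hw, hcon⟩⟩
  obtain ⟨n, ⟨e, heS⟩, he⟩ := nonempty_interior_of_iUnion_of_closed
    (f := fun n : ℕ => {w : S | ‖a w‖ ≤ n}) (fun n => by
      refine isClosed_of_closure_subset fun w hw => ?_
      have := h.mem_of_mem_closure w.2.1 (A := {w | ‖a w‖ ≤ n}) (K := Metric.closedBall 0 n)
        (map_mem_closure continuous_subtype_val hw fun _ h' => h') (isCompact_closedBall _ _)
        fun w hw => by simpa using hw
      simpa using this) (Set.iUnion_eq_univ_iff.2 fun w => exists_nat_ge ‖a w‖)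
  obtain ⟨V, hV, hVe⟩ := mem_nhds_induced _ _ _ |>.1 (mem_interior_iff_mem_nhds.1 he)
  have hen : ‖a e‖ ≤ n := by simpa using interior_subset he
  have hgap : ∀ᶠ w in nhds e, w ∈ V ∧ w ∈ D ∧ (‖a w‖ < n + 1 ∨ n + 2 < ‖a w‖) := by
    filter_upwards [hV, h.isOpen.mem_nhds heS.1,
      h.eventually_notMem heS.1 (isCompact_annulus (n + 1) (n + 2)) fun h' => by linarith [h'.1]]
      with w h1 h2 h3
    refine ⟨h1, h2, ?_⟩
    by_contra! hc
    exact h3 hc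
  obtain ⟨B, hB, hBo, heB⟩ := eventually_nhds_iff.1 hgap
  exact heS.2 (h.mem_union_of_gap (n := n) hBo (fun w hw => (hB w hw).2.1) n.cast_nonneg
    (fun w hw hC hP => @hVe ⟨w, (hB w hw).2.1, not_or.2 ⟨hC, hP⟩⟩ (hB w hw).1)
    (fun w hw => (hB w hw).2.2) heB)

end IsOmittedSelection

/-- Theorem 2: if `f : ℂ × D → ℂ` is holomorphic, `D ⊆ ℂ` nonempty open connected, all
functions `z ↦ f (z, w)` nonconstant, and `a : D → ℂ` is a selection of exceptional
values (`f (z, w) ≠ a w` for all `z ∈ ℂ`, `w ∈ D`), then there is a discrete set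
`E ⊆ D`, closed in `D`, such that `a` is analytic on `D \ E` and `‖a w‖ → ∞` as
`w → w₀` for every `w₀ ∈ E`. -/
theorem stmt_13
    (D : Set ℂ) (hD : IsOpen D) (hDne : D.Nonempty) (hDconn : IsConnected D)
    (f : ℂ × ℂ → ℂ)
    (hf : AnalyticOnNhd ℂ f (Set.univ ×ˢ D))
    (hnc : ∀ w ∈ D, ∃ z₁ z₂ : ℂ, f (z₁, w) ≠ f (z₂, w))
    (a : ℂ → ℂ)
    (ha : ∀ w ∈ D, ∀ z : ℂ, f (z, w) ≠ a w) :
    ∃ E : Set ℂ, E ⊆ D ∧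
      closure E ∩ D ⊆ E ∧
      (∀ w ∈ E, ∃ U : Set ℂ, IsOpen U ∧ w ∈ U ∧ U ∩ E = {w}) ∧
      AnalyticOnNhd ℂ a (D \ E) ∧
      (∀ w₀ ∈ E, Tendsto (fun w => ‖a w‖) (nhdsWithin w₀ (D \ {w₀})) atTop) := by
  have h : IsOmittedSelection f D a := ⟨hD, hf, hnc, ha⟩
  set C := IsOmittedSelection.boundedSet D a
  have hpole : ∀ w ∈ D \ C, w ∈ IsOmittedSelection.poleSet D a := fun w hw =>
    (h.mem_boundedSet_union_poleSet hw.1).resolve_left hw.2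
  refine ⟨D \ C, Set.sdiff_subset, ?_, ?_, ?_, ?_⟩
  · rintro w ⟨hw, hwD⟩
    exact ⟨hwD, closure_minimal (fun w hw => hw.2) h.isOpen_boundedSet.isClosed_compl hw⟩
  · intro w hw
    obtain ⟨U, hU, hUo, hwU⟩ :=
      eventually_nhds_iff.1 (eventually_nhdsWithin_iff.1 (hpole w hw).2.1)
    refine ⟨U, hUo, hwU, Set.Subset.antisymm ?_ (Set.singleton_subset_iff.2 ⟨hwU, hw⟩)⟩
    rintro w' ⟨h1, h2⟩
    by_contra hne
    exact h2.2 (hU w' h1 hne)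
  · intro w hw
    exact h.analyticAt (by_contra fun hC => hw.2 ⟨hw.1, hC⟩)
  · exact fun w hw => (hpole w hw).2.2.mono_left (nhdsWithin_mono w fun w' hw' => hw'.2)
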